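/- arXiv:1002.2662 — 3 statements merged into one kernel-verified Lean document; each statement's English description precedes it below -/
import Mathlib

section
/- Fix an integer N ≥ 2 and ε₀ ∈ ℤ/2. Let M⁰ and M¹ be ℤ-graded ℂ-vector spaces whose gradings are bounded below, and for each ε ∈ ℤ/2 let d_ε : M^ε → M^{ε+1} be a linear map admitting a decomposition d_ε = Σ_{l=0}^{N} d_ε^{(l)}, where d_ε^{(l)} is homogeneous of degree N+1−2l; assume d_{ε+1} ∘ d_ε = 0 for both ε, and assume ker d^{(0)}_{ε₀−1} = im d^{(0)}_{ε₀}. Set Fil^k M^{ε₀} := ⊕_{g ≤ k} (M^{ε₀})_g, H^{ε₀} := ker d_{ε₀} / im d_{ε₀−1}, and Fil^k H^{ε₀} := image of (ker d_{ε₀}) ∩ Fil^k M^{ε₀} in H^{ε₀}. Then for every k ∈ ℤ there is an isomorphism of ℂ-vector spaces Fil^k H^{ε₀} / Fil^{k−1} H^{ε₀} ≅ (ker d^{(0)}_{ε₀} / im d^{(0)}_{ε₀−1})_k, the degree-k homogeneous part of the homology of the leading complex at M^{ε₀}, induced by sending a homogeneous leading cycle α of degree k to the class of a cycle of d_{ε₀}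 of the form α + (terms of degree < k). -/
/-!
Statement 12: In the setting of Statement 11 (graded vector spaces `V = M^{ε₀}`,
`W = M^{ε₀−1}` with bounded-below gradings, differentials `d : V → W`, `d' : W → V`
decomposed into homogeneous pieces of degrees `N+1−2l`, with `d'∘d = 0 = d∘d'` and
`ker d'^{(0)} = im d^{(0)}`), for every `k ∈ ℤ` there is an isomorphism
`Fil^k H^{ε₀} / Fil^{k−1} H^{ε₀} ≅ (ker d^{(0)} / im d'^{(0)})_k`, where
`H^{ε₀} = ker d / im d'`, induced by sending a homogeneous leading cycle `α` of degree `k`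
to the class of a cycle of `d` of the form `α + (lower degree terms)`.
-/

open Submodule

variable {V W : Type*} [AddCommGroup V] [Module ℂ V] [AddCommGroup W] [Module ℂ W]

/-- The filtration associated to a grading: `Fil^k = ⊕_{g ≤ k}` of the graded pieces. -/
noncomputable def Fil (𝒜 : ℤ → Submodule ℂ V) (k : ℤ) : Submodule ℂ V :=
  ⨆ g : ℤ, ⨆ _ : g ≤ k, 𝒜 g

/-- The homology `ker u / im v` at a space with outgoing differential `u` and incoming
differential `v`. -/
noncomputable abbrev Hlgy (u : V →ₗ[ℂ] W) (v : W →ₗ[ℂ] V) :=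
  ↥(LinearMap.ker u) ⧸ (LinearMap.range v).comap (LinearMap.ker u).subtype

/-- The canonical projection from cycles to homology. -/
noncomputable def mkHlgy (u : V →ₗ[ℂ] W) (v : W →ₗ[ℂ] V) :
    ↥(LinearMap.ker u) →ₗ[ℂ] Hlgy u v :=
  Submodule.mkQ _

/-- The induced filtration on homology: the image in `ker u / im v` of the cycles lying
in `Fil^k`. -/
noncomputable def FilH (𝒜 : ℤ → Submodule ℂ V) (u : V →ₗ[ℂ] W) (v : W →ₗ[ℂ] V) (k : ℤ) :
    Submodule ℂ (Hlgy u v) :=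
  Submodule.map (mkHlgy u v) ((Fil 𝒜 k).comap (LinearMap.ker u).subtype)

/-- The degree-`k` homogeneous part of the homology of the leading complex: the image in
`ker u / im v` of the degree-`k` cycles. -/
noncomputable def HlgyDeg (𝒜 : ℤ → Submodule ℂ V) (u : V →ₗ[ℂ] W) (v : W →ₗ[ℂ] V) (k : ℤ) :
    Submodule ℂ (Hlgy u v) :=
  Submodule.map (mkHlgy u v) ((𝒜 k).comap (LinearMap.ker u).subtype)

theorem le_Fil (𝒜 : ℤ → Submodule ℂ V) {g k : ℤ} (h : g ≤ k) : 𝒜 g ≤ Fil 𝒜 k :=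
  le_iSup₂_of_le g h le_rfl

theorem Fil_le_iff (𝒜 : ℤ → Submodule ℂ V) {k : ℤ} {S : Submodule ℂ V} :
    Fil 𝒜 k ≤ S ↔ ∀ g ≤ k, 𝒜 g ≤ S :=
  iSup₂_le_iff

theorem Fil_mono (𝒜 : ℤ → Submodule ℂ V) {j k : ℤ} (h : j ≤ k) : Fil 𝒜 j ≤ Fil 𝒜 k :=
  (Fil_le_iff 𝒜).2 fun _ hg => le_Fil 𝒜 (hg.trans h)

theorem Fil_eq_bot (𝒜 : ℤ → Submodule ℂ V) {g₀ k : ℤ} (h₀ : ∀ g < g₀, 𝒜 g = ⊥) (hk : k < g₀) :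
    Fil 𝒜 k = ⊥ :=
  eq_bot_iff.2 ((Fil_le_iff 𝒜).2 fun g hg => (h₀ g (hg.trans_lt hk)).le)

theorem exists_mem_Fil {𝒜 : ℤ → Submodule ℂ V} (h : DirectSum.IsInternal 𝒜) (x : V) :
    ∃ m, x ∈ Fil 𝒜 m := by
  have hx : x ∈ ⨆ g, 𝒜 g := h.submodule_iSup_eq_top ▸ mem_top
  induction hx using Submodule.iSup_induction' with
  | mem g x hx => exact ⟨g, le_Fil 𝒜 le_rfl hx⟩
  | zero => exact ⟨0, zero_mem _⟩
  | add x y _ _ hx hy =>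
    obtain ⟨m, hm⟩ := hx
    obtain ⟨n, hn⟩ := hy
    exact ⟨max m n, add_mem (Fil_mono 𝒜 (le_max_left m n) hm) (Fil_mono 𝒜 (le_max_right m n) hn)⟩

/-- The projection onto the degree-`k` part of an internally graded space. -/
noncomputable def gradedProj {𝒜 : ℤ → Submodule ℂ V} (h : DirectSum.IsInternal 𝒜) (k : ℤ) :
    V →ₗ[ℂ] V :=
  (𝒜 k).subtype ∘ₗ DirectSum.component ℂ ℤ (fun g => 𝒜 g) k ∘ₗ
    (LinearEquiv.ofBijective (DirectSum.coeLinearMap 𝒜) h).symm.toLinearMap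

section gradedProj

variable {𝒜 : ℤ → Submodule ℂ V} (h : DirectSum.IsInternal 𝒜)

theorem gradedProj_mem (k : ℤ) (x : V) : gradedProj h k x ∈ 𝒜 k :=
  Subtype.property _

theorem ofBijective_symm_of_mem {g : ℤ} {x : V} (hx : x ∈ 𝒜 g) :
    (LinearEquiv.ofBijective (DirectSum.coeLinearMap 𝒜) h).symm x =
      DirectSum.lof ℂ ℤ (fun g => 𝒜 g) g ⟨x, hx⟩ := by
  rw [LinearEquiv.symm_apply_eq]
  exact (DirectSum.coeLinearMap_lof 𝒜 g ⟨x, hx⟩).symm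

theorem gradedProj_of_mem {k : ℤ} {x : V} (hx : x ∈ 𝒜 k) : gradedProj h k x = x := by
  simp [gradedProj, ofBijective_symm_of_mem h hx, DirectSum.component.lof_self]

theorem gradedProj_of_mem_ne {g k : ℤ} (hgk : g ≠ k) {x : V} (hx : x ∈ 𝒜 g) :
    gradedProj h k x = 0 := by
  simp [gradedProj, ofBijective_symm_of_mem h hx, DirectSum.component.of, hgk]

theorem gradedProj_of_mem_Fil {j k : ℤ} (hjk : j < k) {x : V} (hx : x ∈ Fil 𝒜 j) :
    gradedProj h k x = 0 :=
  (Fil_le_iff 𝒜 (S := LinearMap.ker (gradedProj h k))).2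
    (fun _ hg _ hy => gradedProj_of_mem_ne h (hg.trans_lt hjk).ne hy) hx

theorem sub_gradedProj_mem {k : ℤ} {x : V} (hx : x ∈ Fil 𝒜 k) :
    x - gradedProj h k x ∈ Fil 𝒜 (k - 1) := by
  refine (Fil_le_iff 𝒜 (S := (Fil 𝒜 (k - 1)).comap (LinearMap.id - gradedProj h k))).2
    (fun g hg y hy => ?_) hx
  rw [mem_comap, LinearMap.sub_apply, LinearMap.id_apply]
  rcases hg.eq_or_lt with rfl | hlt
  · simp [gradedProj_of_mem h hy]
  · rw [gradedProj_of_mem_ne h hlt.ne hy, sub_zero]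
    exact le_Fil 𝒜 (by lia) hy

end gradedProj

/-- A map `f` has leading part `f₀`, homogeneous of degree `c`. -/
structure HasLeadingPart (𝒜 : ℤ → Submodule ℂ V) (ℬ : ℤ → Submodule ℂ W) (c : ℤ)
    (f f₀ : V →ₗ[ℂ] W) : Prop where
  homogeneous : ∀ g, ∀ x ∈ 𝒜 g, f₀ x ∈ ℬ (g + c)
  apply_sub_mem : ∀ g, ∀ x ∈ 𝒜 g, f x - f₀ x ∈ Fil ℬ (g + c - 1)

theorem hasLeadingPart_sum {𝒜 : ℤ → Submodule ℂ V} {ℬ : ℤ → Submodule ℂ W} {N : ℕ}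
    {f : Fin (N + 1) → (V →ₗ[ℂ] W)}
    (hf : ∀ (l : Fin (N + 1)) (g : ℤ), ∀ x ∈ 𝒜 g,
      f l x ∈ ℬ (g + ((N : ℤ) + 1 - 2 * (l : ℕ)))) :
    HasLeadingPart 𝒜 ℬ (N + 1) (∑ l, f l) (f 0) where
  homogeneous g x hx := by simpa using hf 0 g x hx
  apply_sub_mem g x hx := by
    rw [Fin.sum_univ_succ, LinearMap.add_apply, add_sub_cancel_left, LinearMap.sum_apply]
    refine sum_mem fun l _ => le_Fil ℬ ?_ (hf l.succ g x hx)
    rw [Fin.val_succ]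
    lia

namespace HasLeadingPart

variable {𝒜 : ℤ → Submodule ℂ V} {ℬ : ℤ → Submodule ℂ W} {c : ℤ}
  {d d₀ : V →ₗ[ℂ] W} {d' d₀' : W →ₗ[ℂ] V}

theorem sub_mem_Fil (hd : HasLeadingPart 𝒜 ℬ c d d₀) {k : ℤ} {x : V} (hx : x ∈ Fil 𝒜 k) :
    d x - d₀ x ∈ Fil ℬ (k + c - 1) :=
  (Fil_le_iff 𝒜 (S := (Fil ℬ (k + c - 1)).comap (d - d₀))).2
    (fun g hg y hy => Fil_mono ℬ (by lia) (hd.apply_sub_mem g y hy)) hx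

theorem leading_mem_Fil (hd : HasLeadingPart 𝒜 ℬ c d d₀) {k : ℤ} {x : V} (hx : x ∈ Fil 𝒜 k) :
    d₀ x ∈ Fil ℬ (k + c) :=
  (Fil_le_iff 𝒜 (S := (Fil ℬ (k + c)).comap d₀)).2
    (fun g hg y hy => le_Fil ℬ (by lia) (hd.homogeneous g y hy)) hx

theorem mem_Fil (hd : HasLeadingPart 𝒜 ℬ c d d₀) {k : ℤ} {x : V} (hx : x ∈ Fil 𝒜 k) :
    d x ∈ Fil ℬ (k + c) := by
  rw [← sub_add_cancel (d x) (d₀ x)]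
  exact add_mem (Fil_mono ℬ (by lia) (hd.sub_mem_Fil hx)) (hd.leading_mem_Fil hx)

theorem gradedProj_leading (hV : DirectSum.IsInternal 𝒜) (hW : DirectSum.IsInternal ℬ)
    (hd : HasLeadingPart 𝒜 ℬ c d d₀) (k : ℤ) (x : V) :
    gradedProj hW (k + c) (d₀ x) = d₀ (gradedProj hV k x) := by
  have hx : x ∈ ⨆ g, 𝒜 g := hV.submodule_iSup_eq_top ▸ mem_top
  induction hx using Submodule.iSup_induction' with
  | mem g x hx =>
    by_cases hg : g = k
    · subst hg
      rw [gradedProj_of_mem hV hx, gradedProj_of_mem hW (hd.homogeneous g x hx)]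
    · rw [gradedProj_of_mem_ne hV hg hx, map_zero,
        gradedProj_of_mem_ne hW (by lia) (hd.homogeneous g x hx)]
  | zero => simp
  | add x y _ _ hx hy => simp only [map_add, hx, hy]

theorem gradedProj_apply (hV : DirectSum.IsInternal 𝒜) (hW : DirectSum.IsInternal ℬ)
    (hd : HasLeadingPart 𝒜 ℬ c d d₀) {k : ℤ} {x : V} (hx : x ∈ Fil 𝒜 k) :
    gradedProj hW (k + c) (d x) = d₀ (gradedProj hV k x) := by
  rw [← hd.gradedProj_leading hV hW, ← sub_eq_zero, ← map_sub]
  exact gradedProj_of_mem_Fil hW (by lia) (hd.sub_mem_Fil hx)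

/-- Exactness of the leading complex at `W` lifts the top component of an element of `W`
whose image under `d'` has smaller degree than expected. -/
theorem exists_sub_mem_Fil (hV : DirectSum.IsInternal 𝒜) (hW : DirectSum.IsInternal ℬ)
    (hd : HasLeadingPart 𝒜 ℬ c d d₀) (hd' : HasLeadingPart ℬ 𝒜 c d' d₀')
    (hlead : LinearMap.ker d₀' = LinearMap.range d₀) {m n : ℤ} (hn : n < m + c + c) {y : W}
    (hy : y ∈ Fil ℬ (m + c)) (hdy : d' y ∈ Fil 𝒜 n) :
    ∃ b ∈ 𝒜 m, y - d b ∈ Fil ℬ (m + c - 1) := by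
  have hker : gradedProj hW (m + c) y ∈ LinearMap.ker d₀' := by
    rw [LinearMap.mem_ker, ← hd'.gradedProj_apply hW hV hy]
    exact gradedProj_of_mem_Fil hV hn hdy
  rw [hlead] at hker
  obtain ⟨b, hb⟩ := hker
  have hproj : d₀ (gradedProj hV m b) = gradedProj hW (m + c) y := by
    rw [← hd.gradedProj_leading hV hW, hb]
    exact gradedProj_of_mem hW (gradedProj_mem hW _ y)
  refine ⟨gradedProj hV m b, gradedProj_mem hV m b, ?_⟩
  have h₁ := sub_gradedProj_mem hW hy
  have h₂ := hd.apply_sub_mem _ _ (gradedProj_mem hV m b)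
  rw [hproj] at h₂
  simpa using sub_mem h₁ h₂

theorem exists_preimage_mem_Fil (hV : DirectSum.IsInternal 𝒜) (hW : DirectSum.IsInternal ℬ)
    (hWbdd : ∃ g₀ : ℤ, ∀ g < g₀, ℬ g = ⊥)
    (hd : HasLeadingPart 𝒜 ℬ c d d₀) (hd' : HasLeadingPart ℬ 𝒜 c d' d₀')
    (hlead : LinearMap.ker d₀' = LinearMap.range d₀) (hdd : ∀ x, d' (d x) = 0)
    {m : ℤ} {y : W} (hy : y ∈ Fil ℬ (m + c)) (hdy : d' y = 0) :
    ∃ b ∈ Fil 𝒜 m, d b = y := by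
  obtain ⟨g₀, h₀⟩ := hWbdd
  obtain ⟨n, hn⟩ : ∃ n : ℕ, m + c - n < g₀ := ⟨(m + c - g₀ + 1).toNat, by lia⟩
  induction n generalizing m y with
  | zero =>
    rw [Fil_eq_bot ℬ h₀ (by simpa using hn), mem_bot] at hy
    exact ⟨0, zero_mem _, by simp [hy]⟩
  | succ n ih =>
    obtain ⟨b, hb, hyb⟩ := hd.exists_sub_mem_Fil hV hW hd' hlead (n := m + c + c - 1) (by lia) hy
      (hdy ▸ zero_mem _)
    obtain ⟨b', hb', hdb₂⟩ := ih (m := m - 1) (y := y - d b)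
      (by rwa [show m - 1 + c = m + c - 1 by ring]) (by simp [hdy, hdd]) (by push_cast at hn; lia)
    exact ⟨b + b', add_mem (le_Fil 𝒜 le_rfl hb) (Fil_mono 𝒜 (by lia) hb'), by simp [hdb₂]⟩

/-- The differential `d'` is strict for the filtrations. -/
theorem exists_strict (hV : DirectSum.IsInternal 𝒜) (hW : DirectSum.IsInternal ℬ)
    (hd : HasLeadingPart 𝒜 ℬ c d d₀) (hd' : HasLeadingPart ℬ 𝒜 c d' d₀')
    (hlead : LinearMap.ker d₀' = LinearMap.range d₀) (hdd : ∀ x, d' (d x) = 0)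
    {k : ℤ} {w : W} (hw : d' w ∈ Fil 𝒜 k) :
    ∃ w' ∈ Fil ℬ (k - c), d' w' = d' w := by
  obtain ⟨m, hm⟩ := exists_mem_Fil hW w
  obtain ⟨n, hn⟩ : ∃ n : ℕ, m ≤ k - c + n := ⟨(m - (k - c)).toNat, by lia⟩
  replace hm := Fil_mono ℬ hn hm
  clear hn
  induction n generalizing w with
  | zero => exact ⟨w, by simpa using hm, rfl⟩
  | succ n ih =>
    obtain ⟨b, -, hb⟩ := hd.exists_sub_mem_Fil hV hW hd' hlead (m := k - c + (n + 1) - c) (n := k)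
      (by lia) (y := w) (by simpa using hm) hw
    have hdb : d' (w - d b) = d' w := by simp [hdd]
    obtain ⟨w', hw', h⟩ := ih (w := w - d b) (hdb ▸ hw) (Fil_mono ℬ (by lia) hb)
    exact ⟨w', hw', h.trans hdb⟩

end HasLeadingPart

theorem mkHlgy_eq_zero {u : V →ₗ[ℂ] W} {v : W →ₗ[ℂ] V} {x : LinearMap.ker u} :
    mkHlgy u v x = 0 ↔ (x : V) ∈ LinearMap.range v :=
  Submodule.Quotient.mk_eq_zero _

theorem filtered_homology_graded_pieces (N : ℕ) (hN : 2 ≤ N)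
    (𝒜 : ℤ → Submodule ℂ V) (ℬ : ℤ → Submodule ℂ W)
    (hVint : DirectSum.IsInternal 𝒜) (hWint : DirectSum.IsInternal ℬ)
    (hVbdd : ∃ g₀ : ℤ, ∀ g < g₀, 𝒜 g = ⊥) (hWbdd : ∃ g₀ : ℤ, ∀ g < g₀, ℬ g = ⊥)
    (d : V →ₗ[ℂ] W) (d' : W →ₗ[ℂ] V)
    (du : Fin (N + 1) → (V →ₗ[ℂ] W)) (dv : Fin (N + 1) → (W →ₗ[ℂ] V))
    (hdu : d = ∑ l : Fin (N + 1), du l) (hdv : d' = ∑ l : Fin (N + 1), dv l)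
    (hduhom : ∀ (l : Fin (N + 1)) (g : ℤ), ∀ x ∈ 𝒜 g,
      du l x ∈ ℬ (g + ((N : ℤ) + 1 - 2 * (l : ℕ))))
    (hdvhom : ∀ (l : Fin (N + 1)) (g : ℤ), ∀ y ∈ ℬ g,
      dv l y ∈ 𝒜 (g + ((N : ℤ) + 1 - 2 * (l : ℕ))))
    (hdd : ∀ x : V, d' (d x) = 0) (hdd' : ∀ y : W, d (d' y) = 0)
    (hlead : LinearMap.ker (dv 0) = LinearMap.range (du 0))
    (k : ℤ) :
    ∃ θ : ↥(HlgyDeg 𝒜 (du 0) (dv 0) k) →ₗ[ℂ]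
        (↥(FilH 𝒜 d d' k) ⧸ (FilH 𝒜 d d' (k - 1)).comap (FilH 𝒜 d d' k).subtype),
      Function.Bijective θ ∧
      ∀ (α : V) (hα𝒜 : α ∈ 𝒜 k) (hαker : α ∈ LinearMap.ker (du 0))
        (z : V) (hz : z ∈ LinearMap.ker d) (hzα : z - α ∈ Fil 𝒜 (k - 1))
        (hm1 : mkHlgy (du 0) (dv 0) ⟨α, hαker⟩ ∈ HlgyDeg 𝒜 (du 0) (dv 0) k)
        (hm2 : mkHlgy d d' ⟨z, hz⟩ ∈ FilH 𝒜 d d' k),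
        θ ⟨mkHlgy (du 0) (dv 0) ⟨α, hαker⟩, hm1⟩ =
          Submodule.Quotient.mk ⟨mkHlgy d d' ⟨z, hz⟩, hm2⟩ := by
  subst hdu hdv
  set d : V →ₗ[ℂ] W := ∑ l, du l
  set d' : W →ₗ[ℂ] V := ∑ l, dv l
  have hd : HasLeadingPart 𝒜 ℬ (N + 1) d (du 0) := hasLeadingPart_sum hduhom
  have hd' : HasLeadingPart ℬ 𝒜 (N + 1) d' (dv 0) := hasLeadingPart_sum hdvhom
  let P : Submodule ℂ (LinearMap.ker d) := (Fil 𝒜 k).comap (LinearMap.ker d).subtype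
  have hPker (z : P) : gradedProj hVint k (z : LinearMap.ker d) ∈ LinearMap.ker (du 0) := by
    have hz : (z : V) ∈ Fil 𝒜 k := z.2
    rw [LinearMap.mem_ker, ← hd.gradedProj_apply hVint hWint hz, z.1.2, map_zero]
  let lead : P →ₗ[ℂ] LinearMap.ker (du 0) :=
    (gradedProj hVint k ∘ₗ (LinearMap.ker d).subtype ∘ₗ P.subtype).codRestrict _ hPker
  let φ : P →ₗ[ℂ] HlgyDeg 𝒜 (du 0) (dv 0) k :=
    (mkHlgy (du 0) (dv 0) ∘ₗ lead).codRestrict _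
      fun z => mem_map_of_mem (gradedProj_mem hVint k _)
  let ψ : P →ₗ[ℂ] (FilH 𝒜 d d' k ⧸ (FilH 𝒜 d d' (k - 1)).comap (FilH 𝒜 d d' k).subtype) :=
    mkQ _ ∘ₗ (mkHlgy d d' ∘ₗ P.subtype).codRestrict (FilH 𝒜 d d' k)
      fun z => mem_map_of_mem z.2
  have hlift {α z : V} (hα : α ∈ 𝒜 k) (hzα : z - α ∈ Fil 𝒜 (k - 1)) :
      z ∈ Fil 𝒜 k ∧ gradedProj hVint k z = α := by
    rw [← sub_add_cancel z α, map_add, gradedProj_of_mem hVint hα,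
      gradedProj_of_mem_Fil hVint (by lia) hzα, zero_add]
    exact ⟨add_mem (Fil_mono 𝒜 (by lia) hzα) (le_Fil 𝒜 le_rfl hα), rfl⟩
  have hφ : Function.Surjective φ := by
    rintro ⟨_, ⟨α, hα⟩, hαk, rfl⟩
    have hαk : α ∈ 𝒜 k := hαk
    have hdα : d α ∈ Fil ℬ (k - 1 + (N + 1)) := by
      have := hd.apply_sub_mem k α hαk
      rw [LinearMap.mem_ker.1 hα, sub_zero] at this
      rwa [show k - 1 + ((N : ℤ) + 1) = k + (N + 1) - 1 by ring]
    obtain ⟨b, hb, hdb⟩ :=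
      hd.exists_preimage_mem_Fil hVint hWint hWbdd hd' hlead hdd hdα (hdd α)
    obtain ⟨hz, hproj⟩ := hlift (z := α - b) hαk (by simpa using hb)
    refine ⟨⟨⟨α - b, by simp [hdb]⟩, hz⟩, Subtype.ext ?_⟩
    exact congrArg (mkHlgy (du 0) (dv 0)) (Subtype.ext hproj)
  have hψ : Function.Surjective ψ := by
    intro q
    obtain ⟨⟨_, z, hz, rfl⟩, rfl⟩ := mkQ_surjective _ q
    exact ⟨⟨z, hz⟩, rfl⟩
  have hker : LinearMap.ker φ = LinearMap.ker ψ := by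
    ext ⟨⟨z, hz⟩, hzk⟩
    have hzk : z ∈ Fil 𝒜 k := hzk
    have hφz : (⟨⟨z, hz⟩, hzk⟩ : P) ∈ LinearMap.ker φ ↔
        gradedProj hVint k z ∈ LinearMap.range (dv 0) :=
      Subtype.ext_iff.trans mkHlgy_eq_zero
    have hψz : (⟨⟨z, hz⟩, hzk⟩ : P) ∈ LinearMap.ker ψ ↔
        mkHlgy d d' ⟨z, hz⟩ ∈ FilH 𝒜 d d' (k - 1) :=
      Submodule.Quotient.mk_eq_zero _
    rw [hφz, hψz]
    constructor
    · rintro ⟨β, hβ⟩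
      have hβz : dv 0 (gradedProj hWint (k - (N + 1)) β) = gradedProj hVint k z := by
        rw [← hd'.gradedProj_leading hWint hVint, hβ, sub_add_cancel,
          gradedProj_of_mem hVint (gradedProj_mem hVint k z)]
      have h₁ := hd'.apply_sub_mem _ _ (gradedProj_mem hWint (k - (N + 1)) β)
      rw [hβz, sub_add_cancel] at h₁
      refine ⟨⟨z - d' (gradedProj hWint (k - (N + 1)) β), ?_⟩, ?_, ?_⟩
      · rw [LinearMap.mem_ker, map_sub, hdd', LinearMap.mem_ker.1 hz, sub_zero]
      · change z - d' _ ∈ Fil 𝒜 (k - 1)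
        simpa using sub_mem (sub_gradedProj_mem hVint hzk) h₁
      · rw [← sub_eq_zero, ← map_sub, mkHlgy_eq_zero]
        exact ⟨-gradedProj hWint (k - (N + 1)) β, by simp⟩
    · rintro ⟨⟨z', hz'⟩, hz'k, heq⟩
      have hz'k : z' ∈ Fil 𝒜 (k - 1) := hz'k
      rw [eq_comm, ← sub_eq_zero, ← map_sub, mkHlgy_eq_zero] at heq
      obtain ⟨w, hw⟩ := heq
      replace hw : d' w = z - z' := hw
      obtain ⟨w', hw', hdw'⟩ := hd.exists_strict hVint hWint hd' hlead hdd
        (hw ▸ sub_mem hzk (Fil_mono 𝒜 (by lia) hz'k))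
      have h := hd'.gradedProj_apply hWint hVint hw'
      rw [hdw', hw, sub_add_cancel, map_sub, gradedProj_of_mem_Fil hVint (by lia) hz'k,
        sub_zero] at h
      exact ⟨_, h.symm⟩
  let θ := (φ.quotKerEquivOfSurjective hφ).symm ≪≫ₗ quotEquivOfEq _ _ hker ≪≫ₗ
    ψ.quotKerEquivOfSurjective hψ
  have hθ (z : P) : θ (φ z) = ψ z := by
    have hz : (φ.quotKerEquivOfSurjective hφ).symm (φ z) = Submodule.Quotient.mk z := by
      rw [LinearEquiv.symm_apply_eq]
      rfl
    simp only [θ, LinearEquiv.trans_apply, hz]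
    rfl
  refine ⟨θ.toLinearMap, θ.bijective, fun α hα𝒜 hαker z hz hzα hm1 hm2 => ?_⟩
  obtain ⟨hzk, hproj⟩ := hlift hα𝒜 hzα
  have hφz : φ ⟨⟨z, hz⟩, hzk⟩ = ⟨mkHlgy (du 0) (dv 0) ⟨α, hαker⟩, hm1⟩ :=
    Subtype.ext (congrArg (mkHlgy (du 0) (dv 0)) (Subtype.ext hproj))
  rw [← hφz]
  exact hθ _
end

section
/- Fix N ≥ 2. Let R̃ = ℂ[X_1,…,X_m,B_1,…,B_N] be graded with each X_i homogeneous of positive integer degree and B_k homogeneous of degree 2k, let I_B be the ideal generated by B_1,…,B_N, and set R := R̃/I_B ≅ ℂ[X_1,…,X_m]. Let w ∈ R̃ be homogeneous of degree 2N+2, let M̃ and M̃′ be graded matrix factorizations over R̃ with potential w whose total gradings are bounded below, and let ψ : M̃ → M̃′ be a morphism of matrix factorizations that is homogeneous of degree 0 (preserves the grading). Then ψ is a homotopy equivalence of matrix factorizations over R̃ if and only if the induced morphism ψ̄ : M̃/I_B M̃ → M̃′/I_B M̃′ of matrix factorizations over R (with potential the image of w) is a homotopy equivalence. -/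
/-!
Statement 13: Let `R̃ = ℂ[X_1,…,X_m,B_1,…,B_N]` with `X_i` homogeneous of positive degree
and `B_k` of degree `2k`, `I_B = (B_1,…,B_N)`, `R = R̃/I_B ≅ ℂ[X_1,…,X_m]`, and let `w ∈ R̃`
be homogeneous of degree `2N+2`.  If `M̃, M̃′` are graded matrix factorizations over `R̃`
with potential `w` whose gradings are bounded below, and `ψ : M̃ → M̃′` is a
grading-preserving morphism of matrix factorizations, then `ψ` is a homotopy equivalence
over `R̃` iff the induced morphism `M̃/I_B M̃ → M̃′/I_B M̃′` is a homotopy equivalence over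
`R`.

Graded free modules are modeled as `ι →₀ R̃` with a degree function on the basis `ι`; a
linear map is homogeneous of degree `c` when all of its matrix entries are weighted
homogeneous of the appropriate degrees.
-/

open MvPolynomial

section MFdefs

variable {S : Type*} [CommRing S] {A0 A1 B0 B1 : Type*}
  [AddCommGroup A0] [AddCommGroup A1] [AddCommGroup B0] [AddCommGroup B1]
  [Module S A0] [Module S A1] [Module S B0] [Module S B1]

/-- `(f0, f1)` is a morphism of matrix factorizations from `(dA0, dA1)` to `(dB0, dB1)`. -/
def IsMFMorphism (dA0 : A0 →ₗ[S] A1) (dA1 : A1 →ₗ[S] A0)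
    (dB0 : B0 →ₗ[S] B1) (dB1 : B1 →ₗ[S] B0)
    (f0 : A0 →ₗ[S] B0) (f1 : A1 →ₗ[S] B1) : Prop :=
  f1.comp dA0 = dB0.comp f0 ∧ f0.comp dA1 = dB1.comp f1

/-- The morphisms `(f0, f1)` and `(g0, g1)` of matrix factorizations are homotopic. -/
def MFHomotopic (dA0 : A0 →ₗ[S] A1) (dA1 : A1 →ₗ[S] A0)
    (dB0 : B0 →ₗ[S] B1) (dB1 : B1 →ₗ[S] B0)
    (f0 g0 : A0 →ₗ[S] B0) (f1 g1 : A1 →ₗ[S] B1) : Prop :=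
  ∃ (h0 : A0 →ₗ[S] B1) (h1 : A1 →ₗ[S] B0),
    f0 - g0 = dB1.comp h0 + h1.comp dA0 ∧ f1 - g1 = dB0.comp h1 + h0.comp dA1

/-- The morphism `(f0, f1)` of matrix factorizations is a homotopy equivalence. -/
def IsMFHomotopyEquiv (dA0 : A0 →ₗ[S] A1) (dA1 : A1 →ₗ[S] A0)
    (dB0 : B0 →ₗ[S] B1) (dB1 : B1 →ₗ[S] B0)
    (f0 : A0 →ₗ[S] B0) (f1 : A1 →ₗ[S] B1) : Prop :=
  ∃ (g0 : B0 →ₗ[S] A0) (g1 : B1 →ₗ[S] A1),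
    IsMFMorphism dB0 dB1 dA0 dA1 g0 g1 ∧
    MFHomotopic dA0 dA1 dA0 dA1 (g0.comp f0) LinearMap.id (g1.comp f1) LinearMap.id ∧
    MFHomotopic dB0 dB1 dB0 dB1 (f0.comp g0) LinearMap.id (f1.comp g1) LinearMap.id

end MFdefs

variable (m N : ℕ)

/-- The grading of `R̃ = ℂ[X_1,…,X_m,B_1,…,B_N]`: `X_i` has degree `dX i` and `B_k` has
degree `2k`. -/
def wtF (dX : Fin m → ℕ) : (Fin m ⊕ Fin N) → ℤ :=
  Sum.elim (fun i => (dX i : ℤ)) (fun kk => 2 * ((kk : ℕ) + 1))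

/-- The reduction `R̃ → R̃/I_B ≅ ℂ[X_1,…,X_m]` sending every `B_k` to `0`. -/
noncomputable def piB : MvPolynomial (Fin m ⊕ Fin N) ℂ →+* MvPolynomial (Fin m) ℂ :=
  (aeval (Sum.elim MvPolynomial.X (fun _ => (0 : MvPolynomial (Fin m) ℂ)))).toRingHom

/-- The reduction modulo `I_B` of a linear map between graded free `R̃`-modules
(`M̃/I_B M̃ → M̃′/I_B M̃′`): reduce all matrix entries. -/
noncomputable def redMap {ι κ : Type*}
    (f : (ι →₀ MvPolynomial (Fin m ⊕ Fin N) ℂ) →ₗ[MvPolynomial (Fin m ⊕ Fin N) ℂ]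
      (κ →₀ MvPolynomial (Fin m ⊕ Fin N) ℂ)) :
    (ι →₀ MvPolynomial (Fin m) ℂ) →ₗ[MvPolynomial (Fin m) ℂ]
      (κ →₀ MvPolynomial (Fin m) ℂ) :=
  Finsupp.lsum ℕ fun i => LinearMap.toSpanSingleton _ _
    (Finsupp.mapRange (piB m N) (map_zero _) (f (Finsupp.single i 1)))

/-- A linear map between graded free modules (with basis degree functions `δι`, `δκ`) is
homogeneous of degree `c` iff each matrix entry is weighted homogeneous of the appropriate
degree. -/
def HomogMap {ι κ : Type*} (dX : Fin m → ℕ) (δι : ι → ℤ) (δκ : κ → ℤ) (c : ℤ)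
    (f : (ι →₀ MvPolynomial (Fin m ⊕ Fin N) ℂ) →ₗ[MvPolynomial (Fin m ⊕ Fin N) ℂ]
      (κ →₀ MvPolynomial (Fin m ⊕ Fin N) ℂ)) : Prop :=
  ∀ (i : ι) (j : κ),
    ((f (Finsupp.single i 1)) j).IsWeightedHomogeneous (wtF m N dX) (δι i + c - δκ j)

section Contraction

/-- The endomorphism `D` admits a contracting homotopy. -/
def HasContraction {S : Type*} [CommRing S] {T : Type*} [AddCommGroup T] [Module S T]
    (D : Module.End S T) : Prop :=
  ∃ H : Module.End S T, D * H + H * D = 1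

lemma HasContraction.conj {S : Type*} [CommRing S] {T T' : Type*} [AddCommGroup T] [Module S T]
    [AddCommGroup T'] [Module S T'] (e : T ≃ₗ[S] T') {D : Module.End S T}
    (h : HasContraction D) : HasContraction (e.conj D) := by
  obtain ⟨H, hH⟩ := h
  refine ⟨e.conj H, ?_⟩
  simp only [Module.End.mul_eq_comp] at hH ⊢
  rw [← LinearEquiv.conj_comp, ← LinearEquiv.conj_comp, ← map_add, hH]
  exact e.conj_id

lemma conj_mul_self_eq_smul_one {S : Type*} [CommRing S] {T T' : Type*} [AddCommGroup T]
    [Module S T] [AddCommGroup T'] [Module S T'] (e : T ≃ₗ[S] T') {D : Module.End S T} {w : S}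
    (h : D * D = w • 1) : e.conj D * e.conj D = w • 1 := by
  rw [Module.End.mul_eq_comp, ← LinearEquiv.conj_comp, ← Module.End.mul_eq_comp, h, map_smul]
  exact congrArg _ e.conj_id

/-- A null-homotopic invertible endomorphism yields a contraction when `D ^ 2` is central. -/
lemma exists_contraction_of_isUnit {A : Type*} [Ring A] {D H w : A} (hD : D * D = w)
    (hw : ∀ a, w * a = a * w) (hU : IsUnit (D * H + H * D)) :
    ∃ H' : A, D * H' + H' * D = 1 := by
  obtain ⟨U, hU⟩ := hU
  have hcomm : Commute D (U : A) := by
    have h := hw H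
    rw [← hD] at h
    rw [hU, Commute, SemiconjBy, mul_add, add_mul, ← mul_assoc, h]
    noncomm_ring
  have hinv : D * (↑U⁻¹ : A) = ↑U⁻¹ * D := hcomm.units_inv_right
  refine ⟨H * ↑U⁻¹, ?_⟩
  rw [mul_assoc, ← hinv, ← mul_assoc, ← mul_assoc, ← add_mul, ← hU, Units.mul_inv]

end Contraction

section Cone

variable {S : Type*} [CommRing S] {A0 A1 B0 B1 : Type*}
  [AddCommGroup A0] [AddCommGroup A1] [AddCommGroup B0] [AddCommGroup B1]
  [Module S A0] [Module S A1] [Module S B0] [Module S B1]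

/-- The differential of the mapping cone of `(f0, f1)`, on the total module. -/
def coneDiff (dA0 : A0 →ₗ[S] A1) (dA1 : A1 →ₗ[S] A0) (dB0 : B0 →ₗ[S] B1) (dB1 : B1 →ₗ[S] B0)
    (f0 : A0 →ₗ[S] B0) (f1 : A1 →ₗ[S] B1) : Module.End S ((A0 × A1) × (B0 × B1)) where
  toFun z := ((-dA1 z.1.2, -dA0 z.1.1), (f0 z.1.1 + dB1 z.2.2, f1 z.1.2 + dB0 z.2.1))
  map_add' x y := by ext <;> simp <;> abel
  map_smul' r x := by ext <;> simp

variable {dA0 : A0 →ₗ[S] A1} {dA1 : A1 →ₗ[S] A0} {dB0 : B0 →ₗ[S] B1} {dB1 : B1 →ₗ[S] B0}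
  {f0 : A0 →ₗ[S] B0} {f1 : A1 →ₗ[S] B1}

lemma coneDiff_mul_self {w : S}
    (hA : dA1.comp dA0 = w • LinearMap.id) (hA' : dA0.comp dA1 = w • LinearMap.id)
    (hB : dB1.comp dB0 = w • LinearMap.id) (hB' : dB0.comp dB1 = w • LinearMap.id)
    (hf : IsMFMorphism dA0 dA1 dB0 dB1 f0 f1) :
    coneDiff dA0 dA1 dB0 dB1 f0 f1 * coneDiff dA0 dA1 dB0 dB1 f0 f1 = w • 1 := by
  have h1 := fun x => LinearMap.congr_fun hA x
  have h2 := fun x => LinearMap.congr_fun hA' x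
  have h3 := fun x => LinearMap.congr_fun hB x
  have h4 := fun x => LinearMap.congr_fun hB' x
  have h5 := fun x => LinearMap.congr_fun hf.1 x
  have h6 := fun x => LinearMap.congr_fun hf.2 x
  simp only [LinearMap.comp_apply, LinearMap.smul_apply, LinearMap.id_apply] at h1 h2 h3 h4 h5 h6
  refine LinearMap.ext fun z => ?_
  simp [coneDiff, h1, h2, h3, h4, h5, h6, Prod.ext_iff]

lemma isMFHomotopyEquiv_of_hasContraction_coneDiff
    (h : HasContraction (coneDiff dA0 dA1 dB0 dB1 f0 f1)) :
    IsMFHomotopyEquiv dA0 dA1 dB0 dB1 f0 f1 := by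
  obtain ⟨H, hH⟩ := h
  let iA0 : A0 →ₗ[S] (A0 × A1) × (B0 × B1) := LinearMap.inl S _ _ ∘ₗ LinearMap.inl S _ _
  let iA1 : A1 →ₗ[S] (A0 × A1) × (B0 × B1) := LinearMap.inl S _ _ ∘ₗ LinearMap.inr S _ _
  let iB0 : B0 →ₗ[S] (A0 × A1) × (B0 × B1) := LinearMap.inr S _ _ ∘ₗ LinearMap.inl S _ _
  let iB1 : B1 →ₗ[S] (A0 × A1) × (B0 × B1) := LinearMap.inr S _ _ ∘ₗ LinearMap.inr S _ _
  let pA0 : (A0 × A1) × (B0 × B1) →ₗ[S] A0 := LinearMap.fst S _ _ ∘ₗ LinearMap.fst S _ _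
  let pA1 : (A0 × A1) × (B0 × B1) →ₗ[S] A1 := LinearMap.snd S _ _ ∘ₗ LinearMap.fst S _ _
  let pB0 : (A0 × A1) × (B0 × B1) →ₗ[S] B0 := LinearMap.fst S _ _ ∘ₗ LinearMap.snd S _ _
  let pB1 : (A0 × A1) × (B0 × B1) →ₗ[S] B1 := LinearMap.snd S _ _ ∘ₗ LinearMap.snd S _ _
  have key (z) : coneDiff dA0 dA1 dB0 dB1 f0 f1 (H z) + H (coneDiff dA0 dA1 dB0 dB1 f0 f1 z) = z :=
    LinearMap.congr_fun hH z
  have DA0 (a) : coneDiff dA0 dA1 dB0 dB1 f0 f1 (iA0 a) = iB0 (f0 a) - iA1 (dA0 a) := by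
    simp [coneDiff, iA0, iA1, iB0]
  have DA1 (a) : coneDiff dA0 dA1 dB0 dB1 f0 f1 (iA1 a) = iB1 (f1 a) - iA0 (dA1 a) := by
    simp [coneDiff, iA0, iA1, iB1]
  have DB0 (b) : coneDiff dA0 dA1 dB0 dB1 f0 f1 (iB0 b) = iB1 (dB0 b) := by
    simp [coneDiff, iB0, iB1]
  have DB1 (b) : coneDiff dA0 dA1 dB0 dB1 f0 f1 (iB1 b) = iB0 (dB1 b) := by
    simp [coneDiff, iB0, iB1]
  have kA0 (a) := key (iA0 a)
  have kA1 (a) := key (iA1 a)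
  have kB0 (b) := key (iB0 b)
  have kB1 (b) := key (iB1 b)
  simp only [DA0, DA1, DB0, DB1, map_sub] at kA0 kA1 kB0 kB1
  refine ⟨pA0 ∘ₗ H ∘ₗ iB0, pA1 ∘ₗ H ∘ₗ iB1, ⟨?_, ?_⟩,
    ⟨pA1 ∘ₗ H ∘ₗ iA0, pA0 ∘ₗ H ∘ₗ iA1, ?_, ?_⟩,
    ⟨-(pB1 ∘ₗ H ∘ₗ iB0), -(pB0 ∘ₗ H ∘ₗ iB1), ?_, ?_⟩⟩
  · ext b
    have := congrArg pA1 (kB0 b)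
    simp [coneDiff, iB0, iB1, pA0, pA1] at this ⊢
    linear_combination (norm := abel) this
  · ext b
    have := congrArg pA0 (kB1 b)
    simp [coneDiff, iB0, iB1, pA0, pA1] at this ⊢
    linear_combination (norm := abel) this
  · ext a
    have := congrArg pA0 (kA0 a)
    simp [coneDiff, iA0, iA1, iB0, pA0, pA1] at this ⊢
    linear_combination (norm := abel) this
  · ext a
    have := congrArg pA1 (kA1 a)
    simp [coneDiff, iA0, iA1, iB1, pA0, pA1] at this ⊢
    linear_combination (norm := abel) this
  · ext b
    have := congrArg pB0 (kB0 b)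
    simp [coneDiff, iB0, iB1, pA0, pB0, pB1] at this ⊢
    linear_combination (norm := abel) this
  · ext b
    have := congrArg pB1 (kB1 b)
    simp [coneDiff, iB0, iB1, pA1, pB0, pB1] at this ⊢
    linear_combination (norm := abel) this

lemma IsMFHomotopyEquiv.hasContraction_coneDiff
    (hf : IsMFMorphism dA0 dA1 dB0 dB1 f0 f1)
    (h : IsMFHomotopyEquiv dA0 dA1 dB0 dB1 f0 f1) :
    HasContraction (coneDiff dA0 dA1 dB0 dB1 f0 f1) := by
  obtain ⟨g0, g1, ⟨hg0, hg1⟩, ⟨h0, h1, hh0, hh1⟩, ⟨k0, k1, hk0, hk1⟩⟩ := h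
  obtain ⟨hf0, hf1⟩ := hf
  let θ0 := f1 ∘ₗ h0 - k0 ∘ₗ f0
  let θ1 := f0 ∘ₗ h1 - k1 ∘ₗ f1
  let k0' := k0 + θ0 ∘ₗ g0
  let k1' := k1 + θ1 ∘ₗ g1
  let H : Module.End S ((A0 × A1) × (B0 × B1)) :=
    { toFun := fun z => ((h1 z.1.2 + g0 z.2.1, h0 z.1.1 + g1 z.2.2),
        (-θ1 (h0 z.1.1) - k1' z.2.2, -θ0 (h1 z.1.2) - k0' z.2.1))
      map_add' := fun x y => by ext <;> simp <;> abel
      map_smul' := fun r x => by ext <;> simp [smul_sub] }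
  replace hf0 := fun x => LinearMap.congr_fun hf0 x
  replace hf1 := fun x => LinearMap.congr_fun hf1 x
  replace hg0 := fun x => LinearMap.congr_fun hg0 x
  replace hg1 := fun x => LinearMap.congr_fun hg1 x
  replace hh0 := fun x => LinearMap.congr_fun hh0 x
  replace hh1 := fun x => LinearMap.congr_fun hh1 x
  replace hk0 := fun x => LinearMap.congr_fun hk0 x
  replace hk1 := fun x => LinearMap.congr_fun hk1 x
  simp only [LinearMap.comp_apply, LinearMap.sub_apply, LinearMap.add_apply,
    LinearMap.id_apply] at hf0 hf1 hg0 hg1 hh0 hh1 hk0 hk1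
  refine ⟨H, LinearMap.ext fun z => ?_⟩
  obtain ⟨⟨a0, a1⟩, b0, b1⟩ := z
  have θcyc0 (a : A0) : dB1 (θ0 a) + θ1 (dA0 a) = 0 := by
    have e1 := hk0 (f0 a)
    have e2 := congrArg f0 (hh0 a)
    simp only [map_sub, map_add] at e2
    simp only [θ0, θ1, LinearMap.sub_apply, LinearMap.comp_apply, map_sub, hf0, ← hf1]
    linear_combination (norm := abel) e1 - e2
  have θcyc1 (a : A1) : dB0 (θ1 a) + θ0 (dA1 a) = 0 := by
    have e1 := hk1 (f1 a)
    have e2 := congrArg f1 (hh1 a)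
    simp only [map_sub, map_add] at e2
    simp only [θ0, θ1, LinearMap.sub_apply, LinearMap.comp_apply, map_sub, ← hf0, hf1]
    linear_combination (norm := abel) e1 - e2
  have E0 : f1 (h0 a0) - dB0 (θ1 (h0 a0)) + θ0 (h1 (dA0 a0)) - k0' (f0 a0) = 0 := by
    have e1 := congrArg θ0 (hh0 a0)
    have e2 := θcyc1 (h0 a0)
    simp only [map_sub, map_add] at e1
    have e3 : k0' (f0 a0) = k0 (f0 a0) + θ0 (g0 (f0 a0)) := rfl
    have e4 : θ0 a0 = f1 (h0 a0) - k0 (f0 a0) := rfl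
    rw [e3]
    linear_combination (norm := abel) -e1 - e2 - e4
  have E1 : f0 (h1 a1) - dB1 (θ0 (h1 a1)) + θ1 (h0 (dA1 a1)) - k1' (f1 a1) = 0 := by
    have e1 := congrArg θ1 (hh1 a1)
    have e2 := θcyc0 (h1 a1)
    simp only [map_sub, map_add] at e1
    have e3 : k1' (f1 a1) = k1 (f1 a1) + θ1 (g1 (f1 a1)) := rfl
    have e4 : θ1 a1 = f0 (h1 a1) - k1 (f1 a1) := rfl
    rw [e3]
    linear_combination (norm := abel) -e1 - e2 - e4
  have K0 : f0 (g0 b0) - b0 = dB1 (k0' b0) + k1' (dB0 b0) := by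
    have e := θcyc0 (g0 b0)
    have e3 : k0' b0 = k0 b0 + θ0 (g0 b0) := rfl
    have e4 : k1' (dB0 b0) = k1 (dB0 b0) + θ1 (g1 (dB0 b0)) := rfl
    rw [e3, e4, map_add, hg0]
    linear_combination (norm := abel) hk0 b0 - e
  have K1 : f1 (g1 b1) - b1 = dB0 (k1' b1) + k0' (dB1 b1) := by
    have e := θcyc1 (g1 b1)
    have e3 : k1' b1 = k1 b1 + θ1 (g1 b1) := rfl
    have e4 : k0' (dB1 b1) = k0 (dB1 b1) + θ0 (g0 (dB1 b1)) := rfl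
    rw [e3, e4, map_add, hg1]
    linear_combination (norm := abel) hk1 b1 - e
  ext
  · simp only [coneDiff, H, Module.End.mul_apply, LinearMap.add_apply, LinearMap.coe_mk,
      AddHom.coe_mk, Module.End.one_apply, Prod.fst_add, map_add, map_neg, map_sub]
    linear_combination (norm := abel) hh0 a0 + hg1 b1
  · simp only [coneDiff, H, Module.End.mul_apply, LinearMap.add_apply, LinearMap.coe_mk,
      AddHom.coe_mk, Module.End.one_apply, Prod.fst_add, Prod.snd_add, map_add, map_neg, map_sub]
    linear_combination (norm := abel) hh1 a1 + hg0 b0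
  · simp only [coneDiff, H, Module.End.mul_apply, LinearMap.add_apply, LinearMap.coe_mk,
      AddHom.coe_mk, Module.End.one_apply, Prod.fst_add, Prod.snd_add, map_add, map_neg, map_sub]
    linear_combination (norm := abel) E1 + K0
  · simp only [coneDiff, H, Module.End.mul_apply, LinearMap.add_apply, LinearMap.coe_mk,
      AddHom.coe_mk, Module.End.one_apply, Prod.snd_add, map_add, map_neg, map_sub]
    linear_combination (norm := abel) E0 + K1

end Cone

section GradedFree

/-- An endomorphism of a free module whose matrix entries strictly lower a bounded below degree
function is locally nilpotent. -/
lemma exists_pow_apply_eq_zero {S J : Type*} [CommRing S] (δ : J → ℤ) {c : ℤ}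
    (hc : ∀ j, c ≤ δ j) (E : Module.End S (J →₀ S))
    (hE : ∀ i j, δ i ≤ δ j → E (Finsupp.single i 1) j = 0) (x : J →₀ S) :
    ∃ n : ℕ, (E ^ n) x = 0 := by
  have hsingle (n : ℕ) : ∀ i, δ i < c + n → (E ^ n) (Finsupp.single i 1) = 0 := by
    induction n with
    | zero => intro i hi; have := hc i; simp at hi; omega
    | succ n ih =>
      intro i hi
      rw [pow_succ, Module.End.mul_apply, ← Finsupp.sum_single (E (Finsupp.single i 1)),
        Finsupp.sum, map_sum]
      refine Finset.sum_eq_zero fun j hj => ?_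
      have hlt : δ j < δ i := by
        by_contra! hle
        exact Finsupp.mem_support_iff.mp hj (hE i j hle)
      rw [← mul_one (E (Finsupp.single i 1) j), ← smul_eq_mul, ← Finsupp.smul_single, map_smul,
        ih j (by push_cast at hi; omega), smul_zero]
  induction x using Finsupp.induction_linear with
  | zero => exact ⟨0, map_zero _⟩
  | add x y hx hy =>
    obtain ⟨n, hn⟩ := hx
    obtain ⟨k, hk⟩ := hy
    refine ⟨n + k, ?_⟩
    rw [map_add]
    nth_rewrite 1 [add_comm n k]
    rw [pow_add, pow_add, Module.End.mul_apply, Module.End.mul_apply, hn, hk, map_zero, map_zero,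
      add_zero]
  | single i r =>
    refine ⟨(δ i - c + 1).toNat, ?_⟩
    rw [← mul_one r, ← smul_eq_mul, ← Finsupp.smul_single, map_smul,
      hsingle _ i (by have := hc i; omega), smul_zero]

lemma isUnit_one_sub_of_locally_nilpotent {S T : Type*} [CommRing S] [AddCommGroup T] [Module S T]
    (E : Module.End S T) (hE : ∀ x, ∃ n : ℕ, (E ^ n) x = 0) : IsUnit (1 - E) := by
  rw [Module.End.isUnit_iff]
  constructor
  · rw [injective_iff_map_eq_zero]
    intro x hx
    have hfix : E x = x := by
      rw [LinearMap.sub_apply, Module.End.one_apply, sub_eq_zero] at hx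
      exact hx.symm
    obtain ⟨n, hn⟩ := hE x
    rw [Module.End.pow_apply, Function.iterate_fixed hfix] at hn
    exact hn
  · intro y
    obtain ⟨n, hn⟩ := hE y
    refine ⟨(∑ i ∈ Finset.range n, E ^ i) y, ?_⟩
    rw [← Module.End.mul_apply, mul_neg_geom_sum, LinearMap.sub_apply, hn, sub_zero,
      Module.End.one_apply]

lemma apply_eq_sum_entries {S ι κ : Type*} [CommRing S] (f : (ι →₀ S) →ₗ[S] (κ →₀ S))
    (x : ι →₀ S) (l : κ) : f x l = x.sum fun j r => r * f (Finsupp.single j 1) l := by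
  conv_lhs => rw [← Finsupp.sum_single x]
  rw [Finsupp.sum, map_sum, Finsupp.finsetSum_apply]
  refine Finset.sum_congr rfl fun j _ => ?_
  rw [← mul_one (x j), ← smul_eq_mul (x j) 1, ← Finsupp.smul_single, map_smul, Finsupp.smul_apply]
  simp

variable {σ : Type*} (wt : σ → ℤ)

lemma weightedHomogeneousComponent_add_mul {p : MvPolynomial σ ℂ} {a : ℤ}
    (hp : p.IsWeightedHomogeneous wt a) (q : MvPolynomial σ ℂ) (n : ℤ) :
    weightedHomogeneousComponent wt (a + n) (p * q) =
      p * weightedHomogeneousComponent wt n q := by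
  classical
  let _ := weightedGradedAlgebra ℂ wt
  have h := DirectSum.coe_decompose_mul_add_of_left_mem (weightedHomogeneousSubmodule ℂ wt)
    (i := a) (j := n) (a := p) (b := q) hp
  have hdec (φ : MvPolynomial σ ℂ) (k : ℤ) :
      (DirectSum.decompose (weightedHomogeneousSubmodule ℂ wt) φ k : MvPolynomial σ ℂ) =
        weightedHomogeneousComponent wt k φ :=
    weightedDecomposition.decompose'_apply ℂ wt φ k
  rwa [hdec, hdec] at h

variable {J : Type*} (δ : J → ℤ)

/-- The degree `c` part of an endomorphism of a graded free module. -/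
noncomputable def degreePart (c : ℤ) (f : Module.End (MvPolynomial σ ℂ) (J →₀ MvPolynomial σ ℂ)) :
    Module.End (MvPolynomial σ ℂ) (J →₀ MvPolynomial σ ℂ) :=
  Finsupp.lsum ℕ fun i => LinearMap.toSpanSingleton _ _
    (Finsupp.onFinset (f (Finsupp.single i 1)).support
      (fun j => weightedHomogeneousComponent wt (δ i + c - δ j) (f (Finsupp.single i 1) j))
      (fun j hj => by
        rw [Finsupp.mem_support_iff]
        intro h
        rw [h, map_zero] at hj
        exact hj rfl))

@[simp]
lemma degreePart_entry (c : ℤ) (f : Module.End (MvPolynomial σ ℂ) (J →₀ MvPolynomial σ ℂ))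
    (i j : J) : degreePart wt δ c f (Finsupp.single i 1) j =
      weightedHomogeneousComponent wt (δ i + c - δ j) (f (Finsupp.single i 1) j) := by
  simp [degreePart]

lemma degreePart_mul_of_right {a : ℤ} (c : ℤ)
    (f k : Module.End (MvPolynomial σ ℂ) (J →₀ MvPolynomial σ ℂ))
    (hk : ∀ i j, (k (Finsupp.single i 1) j).IsWeightedHomogeneous wt (δ i + a - δ j)) :
    degreePart wt δ (a + c) (f * k) = degreePart wt δ c f * k := by
  ext1 i; ext1; ext1 l
  simp only [LinearMap.comp_apply, Finsupp.lsingle_apply, degreePart_entry, Module.End.mul_apply]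
  rw [apply_eq_sum_entries f, apply_eq_sum_entries (degreePart wt δ c f), Finsupp.sum, Finsupp.sum,
    map_sum]
  refine Finset.sum_congr rfl fun j _ => ?_
  rw [degreePart_entry, ← weightedHomogeneousComponent_add_mul wt (hk i j)]
  congr 2
  ring

lemma degreePart_mul_of_left {a : ℤ} (c : ℤ)
    (k f : Module.End (MvPolynomial σ ℂ) (J →₀ MvPolynomial σ ℂ))
    (hk : ∀ i j, (k (Finsupp.single i 1) j).IsWeightedHomogeneous wt (δ i + a - δ j)) :
    degreePart wt δ (a + c) (k * f) = k * degreePart wt δ c f := by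
  ext1 i; ext1; ext1 l
  simp only [LinearMap.comp_apply, Finsupp.lsingle_apply, degreePart_entry, Module.End.mul_apply]
  rw [apply_eq_sum_entries k, apply_eq_sum_entries k,
    Finsupp.sum_of_support_subset (degreePart wt δ c f (Finsupp.single i 1))
      (s := (f (Finsupp.single i 1)).support) ?_ _ (by simp), Finsupp.sum, map_sum]
  · refine Finset.sum_congr rfl fun j _ => ?_
    rw [degreePart_entry, mul_comm _ (k (Finsupp.single j 1) l),
      mul_comm _ (k (Finsupp.single j 1) l), ← weightedHomogeneousComponent_add_mul wt (hk j l)]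
    congr 2
    ring
  · intro j hj
    rw [Finsupp.mem_support_iff, degreePart_entry] at hj
    rw [Finsupp.mem_support_iff]
    intro h
    rw [h, map_zero] at hj
    exact hj rfl

lemma degreePart_add (c : ℤ) (f g : Module.End (MvPolynomial σ ℂ) (J →₀ MvPolynomial σ ℂ)) :
    degreePart wt δ c (f + g) = degreePart wt δ c f + degreePart wt δ c g := by
  ext1 i; ext1; ext1 l
  simp

lemma degreePart_zero_one :
    degreePart wt δ 0 (1 : Module.End (MvPolynomial σ ℂ) (J →₀ MvPolynomial σ ℂ)) = 1 := by
  classical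
  ext1 i; ext1; ext1 l
  simp only [LinearMap.comp_apply, Finsupp.lsingle_apply, degreePart_entry, Module.End.one_apply]
  rw [Finsupp.single_apply]
  split_ifs with h
  · subst h
    rw [add_zero, sub_self]
    exact (isWeightedHomogeneous_one ℂ wt).weightedHomogeneousComponent_same
  · exact map_zero _

/-- With positive weights, a polynomial without constant term has no components of nonpositive
weight. -/
lemma weightedHomogeneousComponent_eq_zero_of_nonpos (hwt : ∀ s, 0 < wt s) {p : MvPolynomial σ ℂ}
    (hp : constantCoeff p = 0) {n : ℤ} (hn : n ≤ 0) : weightedHomogeneousComponent wt n p = 0 := by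
  classical
  ext d
  rw [coeff_weightedHomogeneousComponent, coeff_zero]
  split_ifs with h
  · suffices hd : d = 0 by rw [hd]; exact hp
    rw [← h, Finsupp.weight_apply, Finsupp.sum] at hn
    have hnonneg : ∀ s ∈ d.support, 0 ≤ d s • wt s := fun s _ => nsmul_nonneg (hwt s).le _
    have hzero := (Finset.sum_eq_zero_iff_of_nonneg hnonneg).mp
      (le_antisymm hn (Finset.sum_nonneg hnonneg))
    ext s
    by_contra hs
    have := hzero s (Finsupp.mem_support_iff.mpr hs)
    rw [smul_eq_zero] at this
    exact this.elim hs (hwt s).ne'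
  · rfl

end GradedFree

section Reduction

variable {m N} {ι κ μ : Type*}

local notation "R̃" => MvPolynomial (Fin m ⊕ Fin N) ℂ
local notation "R₀" => MvPolynomial (Fin m) ℂ

lemma constantCoeff_piB (p : R̃) : constantCoeff (piB m N p) = constantCoeff p := by
  have : (constantCoeff (R := ℂ)).comp (piB m N) = constantCoeff := by
    ext i
    · simp [piB]
    · rcases i with i | i <;> simp [piB]
  exact RingHom.congr_fun this p

@[simp]
lemma redMap_single (f : (ι →₀ R̃) →ₗ[R̃] (κ →₀ R̃)) (i : ι) (j : κ) :
    redMap m N f (Finsupp.single i 1) j = piB m N (f (Finsupp.single i 1) j) := by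
  simp [redMap]

lemma redMap_mapRange (f : (ι →₀ R̃) →ₗ[R̃] (κ →₀ R̃)) (x : ι →₀ R̃) :
    redMap m N f (Finsupp.mapRange (piB m N) (map_zero _) x) =
      Finsupp.mapRange (piB m N) (map_zero _) (f x) := by
  ext1 l
  rw [apply_eq_sum_entries, Finsupp.mapRange_apply, apply_eq_sum_entries f,
    Finsupp.sum_mapRange_index (by simp), Finsupp.sum, Finsupp.sum, map_sum]
  exact Finset.sum_congr rfl fun j _ => by rw [redMap_single, map_mul]

lemma redMap_comp (f : (κ →₀ R̃) →ₗ[R̃] (μ →₀ R̃)) (g : (ι →₀ R̃) →ₗ[R̃] (κ →₀ R̃)) :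
    redMap m N (f.comp g) = (redMap m N f).comp (redMap m N g) := by
  ext1 i; ext1; ext1 l
  have hg : redMap m N g (Finsupp.single i 1) =
      Finsupp.mapRange (piB m N) (map_zero _) (g (Finsupp.single i 1)) := by
    ext1 j; simp
  simp only [LinearMap.comp_apply, Finsupp.lsingle_apply, hg, redMap_mapRange]
  simp

lemma redMap_add (f g : (ι →₀ R̃) →ₗ[R̃] (κ →₀ R̃)) :
    redMap m N (f + g) = redMap m N f + redMap m N g := by
  ext1 i; ext1; ext1 l
  simp

lemma redMap_sub (f g : (ι →₀ R̃) →ₗ[R̃] (κ →₀ R̃)) :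
    redMap m N (f - g) = redMap m N f - redMap m N g := by
  ext1 i; ext1; ext1 l
  simp

lemma redMap_id : redMap m N (LinearMap.id : (ι →₀ R̃) →ₗ[R̃] (ι →₀ R̃)) = LinearMap.id := by
  classical
  ext1 i; ext1; ext1 l
  simp only [LinearMap.comp_apply, Finsupp.lsingle_apply, redMap_single, LinearMap.id_apply,
    Finsupp.single_apply]
  split_ifs <;> simp

lemma redMap_surjective : Function.Surjective
    (redMap m N : ((ι →₀ R̃) →ₗ[R̃] (κ →₀ R̃)) → ((ι →₀ R₀) →ₗ[R₀] (κ →₀ R₀))) := by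
  intro f
  refine ⟨Finsupp.lsum ℕ fun i => LinearMap.toSpanSingleton _ _
    (Finsupp.mapRange (rename Sum.inl) (map_zero _) (f (Finsupp.single i 1))), ?_⟩
  ext1 i; ext1; ext1 l
  have (p : R₀) : piB m N (rename Sum.inl p) = p := by
    change aeval _ (rename Sum.inl p) = p
    rw [aeval_rename]
    exact aeval_X_left_apply p
  simp [this]

lemma IsMFMorphism.redMap {ι₀ ι₁ κ₀ κ₁ : Type*}
    {d0 : (ι₀ →₀ R̃) →ₗ[R̃] (ι₁ →₀ R̃)} {d1 : (ι₁ →₀ R̃) →ₗ[R̃] (ι₀ →₀ R̃)}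
    {d0' : (κ₀ →₀ R̃) →ₗ[R̃] (κ₁ →₀ R̃)} {d1' : (κ₁ →₀ R̃) →ₗ[R̃] (κ₀ →₀ R̃)}
    {f0 : (ι₀ →₀ R̃) →ₗ[R̃] (κ₀ →₀ R̃)} {f1 : (ι₁ →₀ R̃) →ₗ[R̃] (κ₁ →₀ R̃)}
    (h : IsMFMorphism d0 d1 d0' d1' f0 f1) :
    IsMFMorphism (redMap m N d0) (redMap m N d1) (redMap m N d0') (redMap m N d1')
      (redMap m N f0) (redMap m N f1) := by
  unfold IsMFMorphism
  simp only [← redMap_comp]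
  exact ⟨congrArg _ h.1, congrArg _ h.2⟩

lemma MFHomotopic.redMap {ι₀ ι₁ κ₀ κ₁ : Type*}
    {d0 : (ι₀ →₀ R̃) →ₗ[R̃] (ι₁ →₀ R̃)} {d1 : (ι₁ →₀ R̃) →ₗ[R̃] (ι₀ →₀ R̃)}
    {d0' : (κ₀ →₀ R̃) →ₗ[R̃] (κ₁ →₀ R̃)} {d1' : (κ₁ →₀ R̃) →ₗ[R̃] (κ₀ →₀ R̃)}
    {f0 g0 : (ι₀ →₀ R̃) →ₗ[R̃] (κ₀ →₀ R̃)} {f1 g1 : (ι₁ →₀ R̃) →ₗ[R̃] (κ₁ →₀ R̃)}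
    (h : MFHomotopic d0 d1 d0' d1' f0 g0 f1 g1) :
    MFHomotopic (redMap m N d0) (redMap m N d1) (redMap m N d0') (redMap m N d1')
      (redMap m N f0) (redMap m N g0) (redMap m N f1) (redMap m N g1) := by
  obtain ⟨h0, h1, e0, e1⟩ := h
  refine ⟨_root_.redMap m N h0, _root_.redMap m N h1, ?_, ?_⟩
  · rw [← redMap_sub, e0, redMap_add, redMap_comp, redMap_comp]
  · rw [← redMap_sub, e1, redMap_add, redMap_comp, redMap_comp]

lemma IsMFHomotopyEquiv.redMap {ι₀ ι₁ κ₀ κ₁ : Type*}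
    {d0 : (ι₀ →₀ R̃) →ₗ[R̃] (ι₁ →₀ R̃)} {d1 : (ι₁ →₀ R̃) →ₗ[R̃] (ι₀ →₀ R̃)}
    {d0' : (κ₀ →₀ R̃) →ₗ[R̃] (κ₁ →₀ R̃)} {d1' : (κ₁ →₀ R̃) →ₗ[R̃] (κ₀ →₀ R̃)}
    {f0 : (ι₀ →₀ R̃) →ₗ[R̃] (κ₀ →₀ R̃)} {f1 : (ι₁ →₀ R̃) →ₗ[R̃] (κ₁ →₀ R̃)}
    (h : IsMFHomotopyEquiv d0 d1 d0' d1' f0 f1) :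
    IsMFHomotopyEquiv (redMap m N d0) (redMap m N d1) (redMap m N d0') (redMap m N d1')
      (redMap m N f0) (redMap m N f1) := by
  obtain ⟨g0, g1, hg, hgf, hfg⟩ := h
  have hgf_red := hgf.redMap
  have hfg_red := hfg.redMap
  simp only [redMap_comp, redMap_id] at hgf_red hfg_red
  exact ⟨_, _, hg.redMap, hgf_red, hfg_red⟩

/-- A homogeneous endomorphism of a bounded below graded free module with scalar square has a
contraction as soon as its reduction has one. -/
lemma hasContraction_of_redMap {J : Type*} (δ : J → ℤ) {b : ℤ} (hb : ∀ j, b ≤ δ j)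
    (dX : Fin m → ℕ) (hdX : ∀ i, 0 < dX i) {c : ℤ} {w : R̃} (D : Module.End R̃ (J →₀ R̃))
    (hD : HomogMap m N dX δ δ c D) (hDw : D * D = w • 1)
    (h : HasContraction (S := R₀) (redMap m N D)) : HasContraction D := by
  obtain ⟨H₀, hH₀⟩ := h
  obtain ⟨H, rfl⟩ := redMap_surjective (N := N) H₀
  have hwt : ∀ s, 0 < wtF m N dX s := by
    rintro (i | k)
    · simpa [wtF] using hdX i
    · simp only [wtF, Sum.elim_inr]; positivity
  let P := degreePart (wtF m N dX) δ
  have hU : D * P (-c) H + P (-c) H * D = P 0 (D * H + H * D) := by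
    have h1 := degreePart_mul_of_left (wtF m N dX) δ (-c) D H hD
    have h2 := degreePart_mul_of_right (wtF m N dX) δ (-c) H D hD
    rw [add_neg_cancel] at h1 h2
    simp only [P]
    rw [degreePart_add, h1, h2]
  let U : Module.End R̃ (J →₀ R̃) := D * H + H * D
  let E : Module.End R̃ (J →₀ R̃) := 1 - U
  have hE : D * P (-c) H + P (-c) H * D = 1 - P 0 E := by
    have hsum : P 0 U + P 0 E = 1 := by
      simp only [P]
      rw [← degreePart_add, show U + E = 1 from add_sub_cancel U 1, degreePart_zero_one]
    rw [hU, ← hsum]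
    exact (add_sub_cancel_right (P 0 U) (P 0 E)).symm
  have hredU : redMap m N U = LinearMap.id := by
    refine (redMap_add (D.comp H) (H.comp D)).trans ?_
    rw [redMap_comp, redMap_comp]
    exact hH₀
  have hredE : redMap m N E = 0 := by
    refine (redMap_sub LinearMap.id U).trans ?_
    rw [redMap_id, hredU]
    exact sub_self (LinearMap.id : (J →₀ R₀) →ₗ[R₀] (J →₀ R₀))
  refine exists_contraction_of_isUnit hDw (H := P (-c) H) (fun a => by simp) ?_
  rw [hE]
  refine isUnit_one_sub_of_locally_nilpotent _ (exists_pow_apply_eq_zero δ hb _ fun i j hij => ?_)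
  simp only [P, degreePart_entry]
  refine weightedHomogeneousComponent_eq_zero_of_nonpos _ hwt ?_ (by omega)
  rw [← constantCoeff_piB, ← redMap_single, hredE]
  simp

end Reduction

section ConeBasis

variable {S : Type*} [CommRing S] {ι₀ ι₁ κ₀ κ₁ : Type*}

/-- The total module of a cone of free modules is free on the disjoint union of the bases. -/
noncomputable def coneEquiv (S : Type*) [CommRing S] (ι₀ ι₁ κ₀ κ₁ : Type*) :
    (((ι₀ →₀ S) × (ι₁ →₀ S)) × ((κ₀ →₀ S) × (κ₁ →₀ S))) ≃ₗ[S] ((ι₀ ⊕ ι₁) ⊕ (κ₀ ⊕ κ₁) →₀ S) :=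
  ((Finsupp.sumFinsuppLEquivProdFinsupp S).symm.prodCongr
    (Finsupp.sumFinsuppLEquivProdFinsupp S).symm).trans
    (Finsupp.sumFinsuppLEquivProdFinsupp S).symm

variable (z : ((ι₀ →₀ S) × (ι₁ →₀ S)) × ((κ₀ →₀ S) × (κ₁ →₀ S)))

@[simp] lemma coneEquiv_apply_inl_inl (i : ι₀) :
    coneEquiv S ι₀ ι₁ κ₀ κ₁ z (.inl (.inl i)) = z.1.1 i := rfl

@[simp] lemma coneEquiv_apply_inl_inr (i : ι₁) :
    coneEquiv S ι₀ ι₁ κ₀ κ₁ z (.inl (.inr i)) = z.1.2 i := rfl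

@[simp] lemma coneEquiv_apply_inr_inl (i : κ₀) :
    coneEquiv S ι₀ ι₁ κ₀ κ₁ z (.inr (.inl i)) = z.2.1 i := rfl

@[simp] lemma coneEquiv_apply_inr_inr (i : κ₁) :
    coneEquiv S ι₀ ι₁ κ₀ κ₁ z (.inr (.inr i)) = z.2.2 i := rfl

@[simp] lemma coneEquiv_symm_single_inl_inl (i : ι₀) (r : S) :
    (coneEquiv S ι₀ ι₁ κ₀ κ₁).symm (Finsupp.single (.inl (.inl i)) r) =
      ((Finsupp.single i r, 0), (0, 0)) := by
  classical
  rw [LinearEquiv.symm_apply_eq]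
  ext ((j | j) | (j | j)) <;> simp [Finsupp.single_apply]

@[simp] lemma coneEquiv_symm_single_inl_inr (i : ι₁) (r : S) :
    (coneEquiv S ι₀ ι₁ κ₀ κ₁).symm (Finsupp.single (.inl (.inr i)) r) =
      ((0, Finsupp.single i r), (0, 0)) := by
  classical
  rw [LinearEquiv.symm_apply_eq]
  ext ((j | j) | (j | j)) <;> simp [Finsupp.single_apply]

@[simp] lemma coneEquiv_symm_single_inr_inl (i : κ₀) (r : S) :
    (coneEquiv S ι₀ ι₁ κ₀ κ₁).symm (Finsupp.single (.inr (.inl i)) r) =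
      ((0, 0), (Finsupp.single i r, 0)) := by
  classical
  rw [LinearEquiv.symm_apply_eq]
  ext ((j | j) | (j | j)) <;> simp [Finsupp.single_apply]

@[simp] lemma coneEquiv_symm_single_inr_inr (i : κ₁) (r : S) :
    (coneEquiv S ι₀ ι₁ κ₀ κ₁).symm (Finsupp.single (.inr (.inr i)) r) =
      ((0, 0), (0, Finsupp.single i r)) := by
  classical
  rw [LinearEquiv.symm_apply_eq]
  ext ((j | j) | (j | j)) <;> simp [Finsupp.single_apply]

end ConeBasis

theorem homotopy_equivalence_iff_reduction (hN : 2 ≤ N)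
    (dX : Fin m → ℕ) (hdX : ∀ i, 0 < dX i)
    (w : MvPolynomial (Fin m ⊕ Fin N) ℂ)
    (hw : w.IsWeightedHomogeneous (wtF m N dX) (2 * (N : ℤ) + 2))
    {ι₀ ι₁ κ₀ κ₁ : Type*}
    (δι₀ : ι₀ → ℤ) (δι₁ : ι₁ → ℤ) (δκ₀ : κ₀ → ℤ) (δκ₁ : κ₁ → ℤ)
    (hbdd : ∃ c : ℤ, (∀ i, c ≤ δι₀ i) ∧ (∀ i, c ≤ δι₁ i) ∧ (∀ j, c ≤ δκ₀ j) ∧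
      (∀ j, c ≤ δκ₁ j))
    (d0 : (ι₀ →₀ MvPolynomial (Fin m ⊕ Fin N) ℂ) →ₗ[MvPolynomial (Fin m ⊕ Fin N) ℂ]
      (ι₁ →₀ MvPolynomial (Fin m ⊕ Fin N) ℂ))
    (d1 : (ι₁ →₀ MvPolynomial (Fin m ⊕ Fin N) ℂ) →ₗ[MvPolynomial (Fin m ⊕ Fin N) ℂ]
      (ι₀ →₀ MvPolynomial (Fin m ⊕ Fin N) ℂ))
    (d0' : (κ₀ →₀ MvPolynomial (Fin m ⊕ Fin N) ℂ) →ₗ[MvPolynomial (Fin m ⊕ Fin N) ℂ]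
      (κ₁ →₀ MvPolynomial (Fin m ⊕ Fin N) ℂ))
    (d1' : (κ₁ →₀ MvPolynomial (Fin m ⊕ Fin N) ℂ) →ₗ[MvPolynomial (Fin m ⊕ Fin N) ℂ]
      (κ₀ →₀ MvPolynomial (Fin m ⊕ Fin N) ℂ))
    (hmf1 : d1.comp d0 = w • LinearMap.id) (hmf2 : d0.comp d1 = w • LinearMap.id)
    (hmf1' : d1'.comp d0' = w • LinearMap.id) (hmf2' : d0'.comp d1' = w • LinearMap.id)
    (hd0 : HomogMap m N dX δι₀ δι₁ ((N : ℤ) + 1) d0)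
    (hd1 : HomogMap m N dX δι₁ δι₀ ((N : ℤ) + 1) d1)
    (hd0' : HomogMap m N dX δκ₀ δκ₁ ((N : ℤ) + 1) d0')
    (hd1' : HomogMap m N dX δκ₁ δκ₀ ((N : ℤ) + 1) d1')
    (ψ0 : (ι₀ →₀ MvPolynomial (Fin m ⊕ Fin N) ℂ) →ₗ[MvPolynomial (Fin m ⊕ Fin N) ℂ]
      (κ₀ →₀ MvPolynomial (Fin m ⊕ Fin N) ℂ))
    (ψ1 : (ι₁ →₀ MvPolynomial (Fin m ⊕ Fin N) ℂ) →ₗ[MvPolynomial (Fin m ⊕ Fin N) ℂ]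
      (κ₁ →₀ MvPolynomial (Fin m ⊕ Fin N) ℂ))
    (hψ : IsMFMorphism d0 d1 d0' d1' ψ0 ψ1)
    (hψ0 : HomogMap m N dX δι₀ δκ₀ 0 ψ0) (hψ1 : HomogMap m N dX δι₁ δκ₁ 0 ψ1) :
    IsMFHomotopyEquiv d0 d1 d0' d1' ψ0 ψ1 ↔
      IsMFHomotopyEquiv (redMap m N d0) (redMap m N d1) (redMap m N d0') (redMap m N d1')
        (redMap m N ψ0) (redMap m N ψ1) := by
  refine ⟨fun h => h.redMap, fun h => ?_⟩
  obtain ⟨c, hι₀, hι₁, hκ₀, hκ₁⟩ := hbdd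
  let e := coneEquiv (MvPolynomial (Fin m ⊕ Fin N) ℂ) ι₀ ι₁ κ₀ κ₁
  let e' := coneEquiv (MvPolynomial (Fin m) ℂ) ι₀ ι₁ κ₀ κ₁
  let D := e.conj (coneDiff d0 d1 d0' d1' ψ0 ψ1)
  let δ : (ι₀ ⊕ ι₁) ⊕ (κ₀ ⊕ κ₁) → ℤ :=
    Sum.elim (Sum.elim (fun i => δι₀ i - (N + 1)) (fun i => δι₁ i - (N + 1))) (Sum.elim δκ₀ δκ₁)
  have hδ : ∀ j, c - (N + 1) ≤ δ j := by
    rintro ((j | j) | (j | j)) <;> simp only [δ, Sum.elim_inl, Sum.elim_inr]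
    · linarith [hι₀ j]
    · linarith [hι₁ j]
    · linarith [hκ₀ j]
    · linarith [hκ₁ j]
  have hDhom : HomogMap m N dX δ δ (N + 1) D := by
    have zero_case (n : ℤ) : (0 : MvPolynomial (Fin m ⊕ Fin N) ℂ).IsWeightedHomogeneous
      (wtF m N dX) n := isWeightedHomogeneous_zero _ _ _
    rintro ((i | i) | (i | i)) ((j | j) | (j | j)) <;>
      simp only [D, e, δ, LinearEquiv.conj_apply_apply, coneEquiv_symm_single_inl_inl,
        coneEquiv_symm_single_inl_inr, coneEquiv_symm_single_inr_inl,
        coneEquiv_symm_single_inr_inr, coneEquiv_apply_inl_inl, coneEquiv_apply_inl_inr,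
        coneEquiv_apply_inr_inl, coneEquiv_apply_inr_inr, coneDiff, LinearMap.coe_mk,
        AddHom.coe_mk, map_zero, add_zero, zero_add, neg_zero, Finsupp.coe_zero, Pi.zero_apply,
        zero_case, Sum.elim_inl, Sum.elim_inr, Finsupp.coe_neg, Pi.neg_apply]
    · exact (congrArg (IsWeightedHomogeneous _ _) (by ring)).mp (hd0 i j).neg
    · exact (congrArg (IsWeightedHomogeneous _ _) (by ring)).mp (hψ0 i j)
    · exact (congrArg (IsWeightedHomogeneous _ _) (by ring)).mp (hd1 i j).neg
    · exact (congrArg (IsWeightedHomogeneous _ _) (by ring)).mp (hψ1 i j)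
    · exact hd0' i j
    · exact hd1' i j
  have hDred : redMap m N D = e'.conj (coneDiff (redMap m N d0) (redMap m N d1)
      (redMap m N d0') (redMap m N d1') (redMap m N ψ0) (redMap m N ψ1)) := by
    ext1 i; ext1; ext1 j
    rcases i with ((i | i) | (i | i)) <;> rcases j with ((j | j) | (j | j)) <;>
      simp only [LinearMap.comp_apply, Finsupp.lsingle_apply, redMap_single, D, e, e',
        LinearEquiv.conj_apply_apply, coneEquiv_symm_single_inl_inl,
        coneEquiv_symm_single_inl_inr, coneEquiv_symm_single_inr_inl,
        coneEquiv_symm_single_inr_inr, coneEquiv_apply_inl_inl, coneEquiv_apply_inl_inr,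
        coneEquiv_apply_inr_inl, coneEquiv_apply_inr_inr, coneDiff, LinearMap.coe_mk,
        AddHom.coe_mk, map_zero, add_zero, zero_add, neg_zero, Finsupp.coe_zero, Pi.zero_apply,
        Finsupp.coe_neg, Pi.neg_apply, map_neg]
  have hDsq : D * D = w • 1 :=
    conj_mul_self_eq_smul_one e (coneDiff_mul_self hmf1 hmf2 hmf1' hmf2' hψ)
  have hD : HasContraction D := by
    refine hasContraction_of_redMap δ hδ dX hdX D hDhom hDsq ?_
    rw [hDred]
    exact (h.hasContraction_coneDiff hψ.redMap).conj e'
  refine isMFHomotopyEquiv_of_hasContraction_coneDiff ?_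
  have := hD.conj e.symm
  rwa [LinearEquiv.conj_symm_conj] at this
end

section
/- Fix N ≥ 2. Let R̂ = ℂ[X_1,…,X_n] with each X_i homogeneous of positive integer degree (n = 0, i.e. R̂ = ℂ, is allowed), and let R be a graded commutative unital R̂-algebra. Let a_1,…,a_k, b_1,…,b_k be homogeneous elements of R with deg a_j + deg b_j = 2N+2 for all j and Σ_{j=1}^k a_j b_j = w ∈ R̂. Suppose that for some 1 ≤ l ≤ k the pair (R, {b_1,…,b_l}) is a nice pair over R̂. Let R′ := R/(b_1,…,b_l) and P : R → R′ the quotient map. Then the Koszul matrix factorization ((a_1,b_1); (a_2,b_2); …; (a_k,b_k))_R is homotopy equivalent, as a graded matrix factorization over R̂ with potential w, to the Koszul matrix factorization ((P(a_{l+1}),P(b_{l+1})); …; (P(a_k),P(b_k)))_{R′}. -/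
/-!
Statement 15: Let `R̂ = ℂ[X_1,…,X_n]` with `X_i` homogeneous of positive degree, `R` a
graded commutative unital `R̂`-algebra, and `a_1,…,a_k, b_1,…,b_k` homogeneous elements of
`R` with `deg a_j + deg b_j = 2N+2` and `Σ a_j b_j = w ∈ R̂`.  If `(R, {b_1,…,b_l})` is a
nice pair over `R̂` (here `k = l + r`), then the Koszul factorization
`((a_1,b_1);…;(a_k,b_k))_R` is homotopy equivalent, as a graded matrix factorization over
`R̂` with potential `w`, to `((P(a_{l+1}),P(b_{l+1}));…;(P(a_k),P(b_k)))_{R/(b_1,…,b_l)}`.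

The Koszul factorization of `((a_1,b_1);…;(a_k,b_k))` is modeled on the free module over
the `2^k` basis vectors `e_v`, `v : Fin k → Bool`, with the single (ℤ/2-odd) Koszul
differential; the ℤ/2-grading is by the parity of `v`, and the polynomial grading gives
`e_v` the degree `Σ_{i : v i} (N+1−deg a_i)`.  A homotopy equivalence of graded matrix
factorizations consists of mutually inverse-up-to-(odd)-homotopy `R̂`-linear morphisms
commuting with the differentials and preserving both the ℤ/2-grading and the polynomial
grading.
-/

open MvPolynomial

/-- The Koszul differential of the sequence `((a_1,b_1);…;(a_k,b_k))` on the free module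
with basis `e_v`, `v : Fin k → Bool`:
`(D x) v = Σ_i (−1)^{#{j<i | v j}} (if v i then a i else b i) · x (v with i flipped)`. -/
noncomputable def koszulD {R : Type*} [CommRing R] {k : ℕ} (a b : Fin k → R) :
    ((Fin k → Bool) → R) → ((Fin k → Bool) → R) := fun x v =>
  ∑ i : Fin k,
    (-1 : R) ^ ((Finset.univ.filter fun j => j < i ∧ v j = true).card) *
      (if v i then a i else b i) * x (Function.update v i (!v i))

/-- The polynomial degree of the Koszul basis vector `e_v`. -/
def koszulDeg {k : ℕ} (dega : Fin k → ℤ) (N : ℕ) (v : Fin k → Bool) : ℤ :=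
  ∑ i ∈ Finset.univ.filter (fun i => v i = true), ((N : ℤ) + 1 - dega i)

/-- The ℤ/2-degree (parity) of the Koszul basis vector `e_v`. -/
def parityK {k : ℕ} (v : Fin k → Bool) : ZMod 2 :=
  ((Finset.univ.filter fun i => v i = true).card : ZMod 2)

/-- The set of homogeneous elements of polynomial degree `g` of the Koszul module, for a
ring graded by `ℛ`. -/
def DegSet {R : Type*} [CommRing R] [Module ℂ R] (ℛ : ℤ → Submodule ℂ R) {k : ℕ}
    (dega : Fin k → ℤ) (N : ℕ) (g : ℤ) : Set ((Fin k → Bool) → R) :=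
  {x | ∀ v, x v ∈ ℛ (g - koszulDeg dega N v)}

section Contraction

/-- An exact square-zero endomorphism of a vector space has a contracting homotopy. -/
theorem exists_contraction_of_exact {F V : Type*} [Field F] [AddCommGroup V] [Module F V]
    (d : V →ₗ[F] V) (hd : ∀ x, d (d x) = 0) (hex : ∀ x, d x = 0 → ∃ y, d y = x) :
    ∃ h : V →ₗ[F] V, ∀ x, d (h x) + h (d x) = x := by
  obtain ⟨s, hs⟩ := d.rangeRestrict.exists_rightInverse_of_surjective
    (LinearMap.range_eq_top.2 d.surjective_rangeRestrict)
  obtain ⟨u, hu⟩ := LinearMap.exists_extend s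
  have hdu : ∀ x, d (u (d x)) = d x := fun x => by
    have h1 : u (d x) = s ⟨d x, LinearMap.mem_range_self d x⟩ :=
      LinearMap.congr_fun hu ⟨d x, LinearMap.mem_range_self d x⟩
    rw [h1]
    exact congrArg Subtype.val
      (LinearMap.congr_fun hs (⟨d x, LinearMap.mem_range_self d x⟩ : LinearMap.range d))
  refine ⟨u - d ∘ₗ u ∘ₗ u, fun x => ?_⟩
  obtain ⟨y, hy⟩ := hex (u (d x) - x) (by rw [map_sub, hdu, sub_self])
  have h2 : d (u (u (d x) - x)) = u (d x) - x := by rw [← hy, hdu]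
  simp only [LinearMap.sub_apply, LinearMap.comp_apply, map_sub, hd] at h2 ⊢
  rw [sub_zero, sub_eq_iff_eq_add.1 h2]
  abel

/-- An endomorphism of a projective module that is square-zero and exact modulo a maximal ideal
is contractible modulo that ideal. -/
theorem exists_contraction_mod_maximal {S K : Type*} [CommRing S] [AddCommGroup K] [Module S K]
    [Module.Projective S K] (𝔪 : Ideal S) [𝔪.IsMaximal] (d : K →ₗ[S] K)
    (hd : ∀ x, d (d x) ∈ 𝔪 • (⊤ : Submodule S K))
    (hex : ∀ x, d x ∈ 𝔪 • (⊤ : Submodule S K) → ∃ y, x - d y ∈ 𝔪 • (⊤ : Submodule S K)) :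
    ∃ η : K →ₗ[S] K, ∀ x, d (η x) + η (d x) - x ∈ 𝔪 • (⊤ : Submodule S K) := by
  let := Ideal.Quotient.field 𝔪
  let Q : Submodule S K := 𝔪 • ⊤
  have : IsScalarTower S (S ⧸ 𝔪) (K ⧸ Q) := IsScalarTower.of_algebraMap_smul fun _ _ => rfl
  have hQ : Q ≤ Q.comap d := by
    rw [← Submodule.map_le_iff_le_comap, Submodule.map_smul'']
    exact Submodule.smul_mono le_rfl le_top
  let dV : (K ⧸ Q) →ₗ[S ⧸ 𝔪] (K ⧸ Q) :=
    LinearMap.extendScalarsOfSurjective Ideal.Quotient.mk_surjective (Q.mapQ Q d hQ)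
  have hdV : ∀ x, dV (Q.mkQ x) = Q.mkQ (d x) := fun x => rfl
  obtain ⟨h, hh⟩ := exists_contraction_of_exact dV
    (fun x => by
      obtain ⟨x, rfl⟩ := Q.mkQ_surjective x
      rw [hdV, hdV]
      exact (Submodule.Quotient.mk_eq_zero Q).2 (hd x))
    (fun x hx => by
      obtain ⟨x, rfl⟩ := Q.mkQ_surjective x
      rw [hdV] at hx
      obtain ⟨y, hy⟩ := hex x ((Submodule.Quotient.mk_eq_zero Q).1 hx)
      exact ⟨Q.mkQ y, ((Submodule.Quotient.eq Q).2 hy).symm⟩)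
  obtain ⟨η, hη⟩ := Module.projective_lifting_property Q.mkQ
    (h.restrictScalars S ∘ₗ Q.mkQ) Q.mkQ_surjective
  have hη' : ∀ x, Q.mkQ (η x) = h (Q.mkQ x) := fun x => LinearMap.congr_fun hη x
  refine ⟨η, fun x => (Submodule.Quotient.mk_eq_zero Q).1 ?_⟩
  change Q.mkQ (d (η x) + η (d x) - x) = 0
  rw [map_sub, map_add, ← hdV, hη', hη', ← hdV, hh, sub_self]

end Contraction

section IdealOfVars

variable {σ k : Type*}

theorem sub_C_constantCoeff_mem_idealOfVars [CommRing k] (p : MvPolynomial σ k) :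
    p - C (constantCoeff p) ∈ idealOfVars σ k := by
  induction p using MvPolynomial.induction_on with
  | C a => simp
  | add p q hp hq =>
    rw [map_add, map_add, add_sub_add_comm]
    exact add_mem hp hq
  | mul_X p i _ =>
    simpa using Ideal.mul_mem_left _ p (Ideal.subset_span (Set.mem_range_self i))

theorem isMaximal_idealOfVars [Field k] : (idealOfVars σ k).IsMaximal := by
  have : idealOfVars σ k = RingHom.ker (constantCoeff : MvPolynomial σ k →+* k) := by
    refine le_antisymm (Ideal.span_le.2 ?_) fun p hp => ?_
    · rintro _ ⟨i, rfl⟩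
      simp [RingHom.mem_ker]
    · simpa [(RingHom.mem_ker).1 hp] using sub_C_constantCoeff_mem_idealOfVars p
  rw [this]
  exact RingHom.ker_isMaximal_of_surjective _ fun a => ⟨C a, by simp⟩

end IdealOfVars

section Graded

open DirectSum

variable {Γ k M : Type*} [AddCommGroup Γ] [DecidableEq Γ]
  [CommRing k] [AddCommGroup M] [Module k M] (ℳ : Γ → Submodule k M) [Decomposition ℳ]

/-- An additive map shifting degrees by `κ` commutes with taking homogeneous components. -/
theorem decompose_map_of_degree (f : M →+ M) (κ : Γ) (hf : ∀ γ, ∀ x ∈ ℳ γ, f x ∈ ℳ (γ + κ))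
    (x : M) (γ : Γ) : (decompose ℳ (f x) γ : M) = f (decompose ℳ x (γ - κ)) := by
  induction x using Decomposition.inductionOn ℳ with
  | zero => simp
  | @homogeneous i m =>
    by_cases h : i = γ - κ
    · have h1 := hf i m m.2
      subst h
      rw [decompose_of_mem_same ℳ m.2]
      rw [sub_add_cancel] at h1
      exact decompose_of_mem_same ℳ h1
    · rw [decompose_of_mem_ne ℳ m.2 h, map_zero]
      exact decompose_of_mem_ne ℳ (hf i m m.2) fun h' => h (eq_sub_of_add_eq h')
  | add m m' hm hm' => simp [hm', hm]

/-- The degree `κ` part of a linear map. -/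
theorem exists_linearMap_component (f : M →ₗ[k] M) (κ : Γ) :
    ∃ f' : M →ₗ[k] M, ∀ γ, ∀ x ∈ ℳ γ, f' x = decompose ℳ (f x) (γ + κ) := by
  refine ⟨toModule k Γ M (fun γ => (ℳ (γ + κ)).subtype ∘ₗ
    DirectSum.component k Γ (fun i => ℳ i) (γ + κ) ∘ₗ
    (decomposeLinearEquiv ℳ).toLinearMap ∘ₗ f ∘ₗ (ℳ γ).subtype) ∘ₗ
      (decomposeLinearEquiv ℳ).toLinearMap, fun γ x hx => ?_⟩
  have : decompose ℳ x = lof k Γ (fun i => ℳ i) γ ⟨x, hx⟩ := decompose_of_mem ℳ hx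
  simp only [LinearMap.comp_apply, LinearEquiv.coe_coe, decomposeLinearEquiv_apply, this,
    toModule_lof]
  rfl

omit [AddCommGroup Γ] in
/-- Two additive maps agreeing on homogeneous elements are equal. -/
theorem eq_of_eq_on_homogeneous {P : Type*} [AddCommGroup P] (f g : M →+ P)
    (h : ∀ γ, ∀ x ∈ ℳ γ, f x = g x) (x : M) : f x = g x := by
  induction x using Decomposition.inductionOn ℳ with
  | zero => simp
  | homogeneous m => exact h _ _ m.2
  | add m m' hm hm' => simp [hm', hm]

omit [AddCommGroup Γ] in
/-- If a property of additive subgroup type holds on homogeneous elements of a subgroup `K`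
closed under homogeneous components, it holds on `K`. -/
theorem mem_of_homogeneous_of_decompose_mem {P : Type*} [AddCommGroup P] (f : M →+ P)
    (Q : AddSubgroup P) (K : Set M) (hK : ∀ x ∈ K, ∀ γ, (decompose ℳ x γ : M) ∈ K)
    (h : ∀ γ, ∀ x ∈ ℳ γ, x ∈ K → f x ∈ Q) {x : M} (hx : x ∈ K) : f x ∈ Q := by
  classical
  rw [← sum_support_decompose ℳ x, map_sum]
  exact sum_mem fun γ _ => h γ _ (decompose ℳ x γ).2 (hK x hx γ)

section MvPolynomial

variable {σ : Type*} [Module (MvPolynomial σ k) M]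
  {ℳ} {wt : σ → Γ} (hX : ∀ t γ, ∀ x ∈ ℳ γ, (X t : MvPolynomial σ k) • x ∈ ℳ (γ + wt t))

include hX

theorem decompose_X_smul (t : σ) (x : M) (γ : Γ) :
    (decompose ℳ ((X t : MvPolynomial σ k) • x) γ : M) =
      (X t : MvPolynomial σ k) • (decompose ℳ x (γ - wt t) : M) :=
  decompose_map_of_degree ℳ (DistribSMul.toAddMonoidHom M (X t : MvPolynomial σ k)) (wt t)
    (hX t) x γ

/-- The degree `κ` part of a linear map of graded modules over a polynomial ring. -/
theorem exists_mvPolynomial_linearMap_component [IsScalarTower k (MvPolynomial σ k) M]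
    (f : M →ₗ[MvPolynomial σ k] M) (κ : Γ) :
    ∃ f' : M →ₗ[MvPolynomial σ k] M,
      ∀ γ, ∀ x ∈ ℳ γ, f' x = decompose ℳ (f x) (γ + κ) := by
  obtain ⟨g, hg⟩ := exists_linearMap_component ℳ (f.restrictScalars k) κ
  have key : ∀ (p : MvPolynomial σ k) (x : M), g (p • x) = p • g x := by
    intro p
    induction p using MvPolynomial.induction_on with
    | C a =>
      intro x
      have h (y : M) : (C a : MvPolynomial σ k) • y = a • y := by
        rw [← algebraMap_eq, algebraMap_smul]
      rw [h, h, map_smul]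
    | add p q hp hq =>
      intro x
      rw [add_smul, map_add, hp, hq, add_smul]
    | mul_X p t hp =>
      intro x
      rw [mul_smul, hp, mul_smul]
      congr 1
      refine eq_of_eq_on_homogeneous ℳ
        (g.toAddMonoidHom.comp (DistribSMul.toAddMonoidHom M (X t : MvPolynomial σ k)))
        ((DistribSMul.toAddMonoidHom M (X t : MvPolynomial σ k)).comp g.toAddMonoidHom)
        (fun γ x hx => ?_) x
      change g ((X t : MvPolynomial σ k) • x) = (X t : MvPolynomial σ k) • g x
      rw [hg _ _ (hX t γ x hx), hg _ _ hx, LinearMap.restrictScalars_apply, map_smul,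
        decompose_X_smul hX, LinearMap.restrictScalars_apply]
      rw [add_right_comm, add_sub_cancel_right]
  exact ⟨{ g with map_smul' := key }, hg⟩

/-- Homogeneous components of elements of `(X) M` are of the form `∑ X_t y_t` with `y_t`
homogeneous. -/
theorem decompose_mem_closure_X_smul {x : M}
    (hx : x ∈ idealOfVars σ k • (⊤ : Submodule (MvPolynomial σ k) M)) (γ : Γ) :
    (decompose ℳ x γ : M) ∈ AddSubgroup.closure
      {z | ∃ t, ∃ y ∈ ℳ (γ - wt t), (X t : MvPolynomial σ k) • y = z} := by
  refine Submodule.smul_induction_on hx (fun r hr m _ => ?_) fun x y hx hy => ?_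
  · induction hr using Submodule.span_induction generalizing m with
    | mem r h =>
      obtain ⟨t, rfl⟩ := h
      rw [decompose_X_smul hX]
      exact AddSubgroup.subset_closure ⟨t, _, (decompose ℳ m (γ - wt t)).2, rfl⟩
    | zero => simp
    | add p q _ _ hp hq =>
      rw [add_smul, decompose_add, DirectSum.add_apply, Submodule.coe_add]
      exact add_mem (hp m trivial) (hq m trivial)
    | smul a p _ hp =>
      rw [smul_eq_mul, mul_comm, mul_smul]
      exact hp _ trivial
  · rw [decompose_add, DirectSum.add_apply, Submodule.coe_add]
    exact add_mem hx hy

theorem decompose_mem_idealOfVars_smul_top {x : M}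
    (hx : x ∈ idealOfVars σ k • (⊤ : Submodule (MvPolynomial σ k) M)) (γ : Γ) :
    (decompose ℳ x γ : M) ∈ idealOfVars σ k • (⊤ : Submodule (MvPolynomial σ k) M) := by
  let Q : Submodule (MvPolynomial σ k) M := idealOfVars σ k • ⊤
  refine (AddSubgroup.closure_le Q.toAddSubgroup).2 ?_ (decompose_mem_closure_X_smul hX hx γ)
  rintro _ ⟨t, y, -, rfl⟩
  have h : (X t : MvPolynomial σ k) • y ∈ Q :=
    Submodule.smul_mem_smul (Ideal.subset_span ⟨t, rfl⟩) Submodule.mem_top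
  exact h

/-- If `Φ` preserves degrees and is zero modulo the variables, which have positive degree, and the
degrees of the module are bounded below, then `1 + Φ` is bijective. -/
theorem bijective_id_add_of_mem_idealOfVars (ht : Γ →+ ℤ) (hwt : ∀ t, 0 < ht (wt t))
    (g₀ : ℤ) (hbdd : ∀ γ, ht γ < g₀ → ℳ γ = ⊥) (Φ : M →ₗ[MvPolynomial σ k] M)
    (hΦ : ∀ γ, ∀ x ∈ ℳ γ, Φ x ∈ ℳ γ)
    (hΦX : ∀ x, Φ x ∈ idealOfVars σ k • (⊤ : Submodule (MvPolynomial σ k) M)) :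
    Function.Bijective (LinearMap.id + Φ : M →ₗ[MvPolynomial σ k] M) := by
  have hnil : ∀ (m : ℕ) (γ : Γ), ht γ < g₀ + m → ∀ x ∈ ℳ γ, (Φ ^ m) x = 0 := by
    intro m
    induction m with
    | zero =>
      intro γ hγ x hx
      rw [hbdd γ (by simpa using hγ)] at hx
      simpa using hx
    | succ m ih =>
      intro γ hγ x hx
      rw [pow_succ, Module.End.mul_apply]
      have h1 := decompose_mem_closure_X_smul hX (hΦX x) γ
      rw [decompose_of_mem_same ℳ (hΦ γ x hx)] at h1
      refine (AddSubgroup.closure_le (LinearMap.ker (Φ ^ m)).toAddSubgroup).2 ?_ h1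
      rintro _ ⟨t, y, hy, rfl⟩
      change (Φ ^ m) _ = 0
      rw [map_smul, ih (γ - wt t) _ y hy, smul_zero]
      rw [map_sub]
      push_cast at hγ
      linarith [hwt t]
  have hloc : ∀ x, ∃ m : ℕ, (Φ ^ m) x = 0 := by
    intro x
    induction x using Decomposition.inductionOn ℳ with
    | zero => exact ⟨0, map_zero _⟩
    | @homogeneous γ x =>
      exact ⟨(ht γ - g₀ + 1).toNat, hnil _ γ (by have := Int.self_le_toNat (ht γ - g₀ + 1); omega)
        x x.2⟩
    | add x y hx hy =>
      obtain ⟨m, hm⟩ := hx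
      obtain ⟨m', hm'⟩ := hy
      refine ⟨m + m', ?_⟩
      rw [map_add, pow_add, Module.End.mul_apply, Module.End.mul_apply, hm', map_zero, add_zero,
        ← Module.End.mul_apply, ← pow_add, add_comm m m', pow_add, Module.End.mul_apply, hm,
        map_zero]
  constructor
  · rw [injective_iff_map_eq_zero]
    intro x hx
    obtain ⟨m, hm⟩ := hloc x
    have h1 : Φ x = -x := (neg_eq_of_add_eq_zero_right hx).symm
    have h2 : ∀ j : ℕ, (Φ ^ j) x = 0 → x = 0 := by
      intro j
      induction j with
      | zero => exact id
      | succ j ih =>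
        intro h
        rw [pow_succ, Module.End.mul_apply, h1, map_neg, neg_eq_zero] at h
        exact ih h
    exact h2 m hm
  · intro x
    obtain ⟨m, hm⟩ := hloc x
    have h2 : ∀ (j : ℕ) (x : M), (Φ ^ j) x = 0 → ∃ y, (LinearMap.id + Φ : M →ₗ[MvPolynomial σ k] M) y = x := by
      intro j
      induction j with
      | zero =>
        intro x h
        exact ⟨0, by rw [map_zero]; exact h.symm⟩
      | succ j ih =>
        intro x h
        rw [pow_succ, Module.End.mul_apply] at h
        obtain ⟨y, hy⟩ := ih _ h
        refine ⟨x - y, ?_⟩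
        rw [map_sub, hy, LinearMap.add_apply, LinearMap.id_apply, add_sub_cancel_right]
    exact h2 m x hm

end MvPolynomial

end Graded

section HomotopyInverse

open DirectSum

variable {Γ σ k M M' : Type*} [AddCommGroup Γ] [DecidableEq Γ] [Field k]
  [AddCommGroup M] [Module k M] [Module (MvPolynomial σ k) M] [IsScalarTower k (MvPolynomial σ k) M]
  [AddCommGroup M'] [Module (MvPolynomial σ k) M']
  {ℳ : Γ → Submodule k M} [Decomposition ℳ] {wt : σ → Γ}

/-- A surjection with homogeneous kernel onto a projective module has a homogeneous projection
onto its kernel. -/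
theorem exists_homogeneous_projection_ker [Module.Projective (MvPolynomial σ k) M']
    (hX : ∀ t γ, ∀ x ∈ ℳ γ, (X t : MvPolynomial σ k) • x ∈ ℳ (γ + wt t))
    (G : M →ₗ[MvPolynomial σ k] M') (hG : Function.Surjective G)
    (hker : ∀ x, G x = 0 → ∀ γ, G (decompose ℳ x γ) = 0) :
    ∃ π : M →ₗ[MvPolynomial σ k] M, (∀ x, G (π x) = 0) ∧ (∀ x, G x = 0 → π x = x) ∧
      ∀ γ, ∀ x ∈ ℳ γ, π x ∈ ℳ γ := by
  obtain ⟨s, hs⟩ := G.exists_rightInverse_of_surjective (LinearMap.range_eq_top.2 hG)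
  have hs' : ∀ y, G (s y) = y := LinearMap.congr_fun hs
  obtain ⟨π, hπ⟩ := exists_mvPolynomial_linearMap_component hX (LinearMap.id - s ∘ₗ G) 0
  have hπ' : ∀ γ, ∀ x ∈ ℳ γ, π x = decompose ℳ (x - s (G x)) γ := fun γ x hx => by
    rw [hπ γ x hx, add_zero]
    rfl
  refine ⟨π, fun x => ?_, fun x hx => ?_, fun γ x hx => ?_⟩
  · refine eq_of_eq_on_homogeneous ℳ ((G ∘ₗ π).toAddMonoidHom) 0 (fun γ x hx => ?_) x
    change G (π x) = 0
    rw [hπ' γ x hx]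
    exact hker _ (by rw [map_sub, hs', sub_self]) γ
  · rw [← sub_eq_zero]
    refine mem_of_homogeneous_of_decompose_mem ℳ (π - LinearMap.id).toAddMonoidHom ⊥
      {x | G x = 0} hker (fun γ x hx h0 => ?_) hx
    change π x - x = 0
    rw [hπ' γ x hx, show G x = 0 from h0, map_zero, sub_zero, decompose_of_mem_same ℳ hx,
      sub_self]
  · rw [hπ' γ x hx]
    exact Subtype.prop _

/-- If the kernel of a surjection of factorizations is exact modulo the variables, then it has a
homogeneous contraction. -/
theorem exists_homogeneous_contraction_ker [Module.Projective (MvPolynomial σ k) M]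
    (hX : ∀ t γ, ∀ x ∈ ℳ γ, (X t : MvPolynomial σ k) • x ∈ ℳ (γ + wt t))
    (ht : Γ →+ ℤ) (hwt : ∀ t, 0 < ht (wt t)) (g₀ : ℤ) (hbdd : ∀ γ, ht γ < g₀ → ℳ γ = ⊥)
    (D : M →ₗ[MvPolynomial σ k] M) (D' : M' →ₗ[MvPolynomial σ k] M')
    (G : M →ₗ[MvPolynomial σ k] M') (hGD : ∀ x, G (D x) = D' (G x))
    (π : M →ₗ[MvPolynomial σ k] M) (hGπ : ∀ x, G (π x) = 0) (hπ : ∀ x, G x = 0 → π x = x)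
    (hπdeg : ∀ γ, ∀ x ∈ ℳ γ, π x ∈ ℳ γ)
    (hker : ∀ x, G x = 0 → ∀ γ, G (decompose ℳ x γ) = 0)
    (κ : Γ) (hD : ∀ γ, ∀ x ∈ ℳ γ, D x ∈ ℳ (γ + κ))
    (w : MvPolynomial σ k) (hDD : ∀ x, D (D x) = w • x)
    (hw : ∀ x : M, w • x ∈ idealOfVars σ k • (⊤ : Submodule (MvPolynomial σ k) M))
    (hex : ∀ x, G x = 0 → D x ∈ idealOfVars σ k • (⊤ : Submodule (MvPolynomial σ k) M) →
      ∃ y, G y = 0 ∧ x - D y ∈ idealOfVars σ k • (⊤ : Submodule (MvPolynomial σ k) M)) :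
    ∃ η : M →ₗ[MvPolynomial σ k] M, (∀ x, G (η x) = 0) ∧
      (∀ x, G x = 0 → D (η x) + η (D x) = x) ∧ (∀ γ, ∀ x ∈ ℳ γ, η x ∈ ℳ (γ - κ)) := by
  let Q : Submodule (MvPolynomial σ k) M := idealOfVars σ k • ⊤
  have := isMaximal_idealOfVars (σ := σ) (k := k)
  let K := LinearMap.ker G
  let p : M →ₗ[MvPolynomial σ k] K := π.codRestrict K hGπ
  have hp : ∀ x : K, p x = x := fun x => Subtype.ext (hπ x x.2)
  have : Module.Projective (MvPolynomial σ k) K :=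
    Module.Projective.of_split K.subtype p (LinearMap.ext hp)
  have hDK : ∀ x, G x = 0 → G (D x) = 0 := fun x hx => by rw [hGD, hx, map_zero]
  let DK : K →ₗ[MvPolynomial σ k] K := D.restrict hDK
  have hQK : ∀ x : K, (x : M) ∈ Q ↔ x ∈ idealOfVars σ k • (⊤ : Submodule (MvPolynomial σ k) K) := by
    refine fun x => ⟨fun hx => ?_, fun hx => ?_⟩
    · have h1 := Submodule.mem_map_of_mem (f := p) hx
      rw [hp, Submodule.map_smul''] at h1
      exact Submodule.smul_mono le_rfl le_top h1
    · have h1 := Submodule.mem_map_of_mem (f := K.subtype) hx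
      rw [Submodule.map_smul''] at h1
      exact Submodule.smul_mono le_rfl le_top h1
  obtain ⟨ηK, hηK⟩ := exists_contraction_mod_maximal (idealOfVars σ k) DK
    (fun x => (hQK _).1 (by
      change D (D x) ∈ Q
      rw [hDD]
      exact hw x))
    (fun x hx => by
      obtain ⟨y, hy, hxy⟩ := hex x x.2 ((hQK _).2 hx)
      exact ⟨⟨y, hy⟩, (hQK _).1 hxy⟩)
  obtain ⟨η₀, hη₀⟩ := exists_mvPolynomial_linearMap_component hX (K.subtype ∘ₗ ηK ∘ₗ p) (-κ)
  have hη₀K : ∀ x, G (η₀ x) = 0 := by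
    refine eq_of_eq_on_homogeneous ℳ (G ∘ₗ η₀).toAddMonoidHom 0 fun γ x hx => ?_
    change G (η₀ x) = 0
    rw [hη₀ γ x hx]
    exact hker _ (ηK (p x)).2 _
  have hη₀deg : ∀ γ, ∀ x ∈ ℳ γ, η₀ x ∈ ℳ (γ - κ) := fun γ x hx => by
    rw [hη₀ γ x hx, ← sub_eq_add_neg]
    exact Subtype.prop _
  let Φ : M →ₗ[MvPolynomial σ k] M := (D ∘ₗ η₀ + η₀ ∘ₗ D - LinearMap.id) ∘ₗ π
  have hΦdeg : ∀ γ, ∀ x ∈ ℳ γ, Φ x ∈ ℳ γ := fun γ x hx => by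
    have h0 := hπdeg γ x hx
    have h1 := hD _ _ (hη₀deg _ _ h0)
    have h2 := hη₀deg _ _ (hD _ _ h0)
    rw [sub_add_cancel] at h1
    rw [add_sub_cancel_right] at h2
    exact sub_mem (add_mem h1 h2) h0
  have hΦK : ∀ x, G (Φ x) = 0 := fun x => by
    change G (D (η₀ (π x)) + η₀ (D (π x)) - π x) = 0
    rw [map_sub, map_add, hDK _ (hη₀K _), hη₀K, hGπ]
    simp
  have hΦQ : ∀ x, Φ x ∈ Q := by
    refine fun x => mem_of_homogeneous_of_decompose_mem ℳ Φ.toAddMonoidHom Q.toAddSubgroup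
      Set.univ (fun _ _ _ => trivial) (fun γ x hx _ => ?_) (Set.mem_univ x)
    have h0 := hπdeg γ x hx
    change D (η₀ (π x)) + η₀ (D (π x)) - π x ∈ Q
    have h1 := decompose_mem_idealOfVars_smul_top hX ((hQK _).2 (hηK (p x))) γ
    have h2 : ((DK (ηK (p x)) + ηK (DK (p x)) - p x : K) : M) =
      D (ηK (p x)) + ηK (DK (p x)) - π x := rfl
    have h3 : p (π x) = p x := hp (p x)
    have h4 : p (D (π x)) = DK (p x) := hp (DK (p x))
    have h5 : D (η₀ (π x)) = decompose ℳ (D (ηK (p x))) γ := by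
      rw [hη₀ _ _ h0, ← sub_eq_add_neg]
      refine (decompose_map_of_degree ℳ D.toAddMonoidHom κ hD _ γ).symm.trans ?_
      change (decompose ℳ (D (ηK (p (π x)))) γ : M) = _
      rw [h3]
    have h6 : η₀ (D (π x)) = decompose ℳ (ηK (DK (p x)) : M) γ := by
      rw [hη₀ _ _ (hD _ _ h0), add_neg_cancel_right]
      change (decompose ℳ (ηK (p (D (π x))) : M) γ : M) = _
      rw [h4]
    rw [h2, decompose_sub, decompose_add, DirectSum.sub_apply, DirectSum.add_apply,
      Submodule.coe_sub, Submodule.coe_add, decompose_of_mem_same ℳ h0, ← h5, ← h6] at h1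
    exact h1
  let e := LinearEquiv.ofBijective _
    (bijective_id_add_of_mem_idealOfVars hX ht hwt g₀ hbdd Φ hΦdeg hΦQ)
  have he : ∀ x, e x = x + Φ x := fun x => rfl
  have heK : ∀ x, G x = 0 → e x = D (η₀ x) + η₀ (D x) := fun x hx => by
    rw [he]
    change x + (D (η₀ (π x)) + η₀ (D (π x)) - π x) = _
    rw [hπ x hx, add_sub_cancel]
  have hesymmK : ∀ x, G x = 0 → G (e.symm x) = 0 := fun x hx => by
    have h1 := congrArg G (he (e.symm x))
    rw [LinearEquiv.apply_symm_apply, hx, map_add, hΦK, add_zero] at h1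
    exact h1.symm
  have heD : ∀ x, G x = 0 → D (e.symm x) = e.symm (D x) := fun x hx => by
    have h1 := hesymmK x hx
    rw [LinearEquiv.eq_symm_apply, heK _ (hDK _ h1), hDD, map_smul]
    have h2 := congrArg D (heK _ h1)
    rw [LinearEquiv.apply_symm_apply, map_add, hDD] at h2
    rw [h2, add_comm]
  refine ⟨e.symm.toLinearMap ∘ₗ η₀, fun x => hesymmK _ (hη₀K x), fun x hx => ?_, fun γ x hx => ?_⟩
  · change D (e.symm (η₀ x)) + e.symm (η₀ (D x)) = x
    rw [heD _ (hη₀K x), ← map_add, ← heK x hx, LinearEquiv.symm_apply_apply]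
  · change e.symm (η₀ x) ∈ _
    have h1 := hη₀deg γ x hx
    have h2 : e.symm (η₀ x) = decompose ℳ (e.symm (η₀ x)) (γ - κ) := by
      rw [LinearEquiv.symm_apply_eq, he]
      have h3 := decompose_map_of_degree ℳ Φ.toAddMonoidHom 0
        (fun γ x hx => by rw [add_zero]; exact hΦdeg γ x hx) (e.symm (η₀ x)) (γ - κ)
      rw [sub_zero] at h3
      have h4 := congrArg (fun z => (decompose ℳ z (γ - κ) : M)) (he (e.symm (η₀ x)))
      simp only [LinearEquiv.apply_symm_apply, decompose_add, DirectSum.add_apply,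
        Submodule.coe_add] at h4
      rw [decompose_of_mem_same ℳ h1] at h4
      exact h4.trans (congrArg _ h3)
    rw [h2]
    exact Subtype.prop _

/-- A surjection of graded factorizations whose kernel is exact modulo the variables has a
homogeneous homotopy inverse, which is moreover a section. -/
theorem exists_homogeneous_homotopy_inverse [Module.Projective (MvPolynomial σ k) M]
    [Module.Projective (MvPolynomial σ k) M']
    (hX : ∀ t γ, ∀ x ∈ ℳ γ, (X t : MvPolynomial σ k) • x ∈ ℳ (γ + wt t))
    (ht : Γ →+ ℤ) (hwt : ∀ t, 0 < ht (wt t)) (g₀ : ℤ) (hbdd : ∀ γ, ht γ < g₀ → ℳ γ = ⊥)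
    (D : M →ₗ[MvPolynomial σ k] M) (D' : M' →ₗ[MvPolynomial σ k] M')
    (G : M →ₗ[MvPolynomial σ k] M') (hG : Function.Surjective G)
    (hGD : ∀ x, G (D x) = D' (G x))
    (hker : ∀ x, G x = 0 → ∀ γ, G (decompose ℳ x γ) = 0)
    (κ : Γ) (hD : ∀ γ, ∀ x ∈ ℳ γ, D x ∈ ℳ (γ + κ))
    (w : MvPolynomial σ k) (hDD : ∀ x, D (D x) = w • x)
    (hw : ∀ x : M, w • x ∈ idealOfVars σ k • (⊤ : Submodule (MvPolynomial σ k) M))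
    (hex : ∀ x, G x = 0 → D x ∈ idealOfVars σ k • (⊤ : Submodule (MvPolynomial σ k) M) →
      ∃ y, G y = 0 ∧ x - D y ∈ idealOfVars σ k • (⊤ : Submodule (MvPolynomial σ k) M)) :
    ∃ G' : M' →ₗ[MvPolynomial σ k] M, (∀ y, G (G' y) = y) ∧ (∀ y, G' (D' y) = D (G' y)) ∧
      (∀ γ, ∀ x ∈ ℳ γ, G' (G x) ∈ ℳ γ) ∧
      ∃ h : M →ₗ[MvPolynomial σ k] M, ∀ x, G' (G x) - x = D (h x) + h (D x) := by
  obtain ⟨π, hGπ, hπ, hπdeg⟩ := exists_homogeneous_projection_ker hX G hG hker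
  obtain ⟨η, hGη, hη, hηdeg⟩ := exists_homogeneous_contraction_ker hX ht hwt g₀ hbdd D D' G hGD π
    hGπ hπ hπdeg hker κ hD w hDD hw hex
  obtain ⟨s, hs⟩ := G.exists_rightInverse_of_surjective (LinearMap.range_eq_top.2 hG)
  have hs' : ∀ y, G (s y) = y := LinearMap.congr_fun hs
  let s₀ : M' →ₗ[MvPolynomial σ k] M := (LinearMap.id - π) ∘ₗ s
  have hs₀ : ∀ x, s₀ (G x) = x - π x := fun x => by
    have h1 := hπ (x - s (G x)) (by rw [map_sub, hs', sub_self])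
    rw [map_sub] at h1
    change s (G x) - π (s (G x)) = _
    rw [sub_eq_sub_iff_sub_eq_sub, ← neg_sub, ← h1, neg_sub]
  have hGs₀ : ∀ y, G (s₀ y) = y := fun y => by
    change G (s y - π (s y)) = y
    rw [map_sub, hs', hGπ, sub_zero]
  have hs₀deg : ∀ γ, ∀ x ∈ ℳ γ, s₀ (G x) ∈ ℳ γ := fun γ x hx => by
    rw [hs₀]
    exact sub_mem hx (hπdeg γ x hx)
  have hD'D' : ∀ y, D' (D' y) = w • y := fun y => by
    rw [← hGs₀ y, ← hGD, ← hGD, hDD, map_smul]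
  let δ : M' →ₗ[MvPolynomial σ k] M := D ∘ₗ s₀ - s₀ ∘ₗ D'
  have hδ : ∀ y, δ y = D (s₀ y) - s₀ (D' y) := fun y => rfl
  have hGδ : ∀ y, G (δ y) = 0 := fun y => by
    rw [hδ, map_sub, hGD, hGs₀, hGs₀, sub_self]
  have hδD : ∀ y, D (δ y) = - δ (D' y) := fun y => by
    rw [hδ, hδ, hD'D', map_sub, hDD, map_smul]
    abel
  let G' := s₀ - η ∘ₗ δ
  have hG' : ∀ y, G' y = s₀ y - η (δ y) := fun y => rfl
  have hGG' : ∀ y, G (G' y) = y := fun y => by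
    rw [hG', map_sub, hGs₀, hGη, sub_zero]
  have hG'D : ∀ y, G' (D' y) = D (G' y) := fun y => by
    have h1 := hη _ (hGδ y)
    rw [hδD, map_neg, ← sub_eq_add_neg, sub_eq_iff_eq_add] at h1
    rw [hG', hG', map_sub, h1, show D (s₀ y) = δ y + s₀ (D' y) by rw [hδ, sub_add_cancel]]
    abel
  refine ⟨G', hGG', hG'D, fun γ x hx => ?_, -(η ∘ₗ (LinearMap.id - G' ∘ₗ G)), fun x => ?_⟩
  · rw [hG', hδ, ← hGD]
    have h1 := hηdeg _ _ (sub_mem (hD _ _ (hs₀deg γ x hx)) (hs₀deg _ _ (hD γ x hx)))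
    rw [add_sub_cancel_right] at h1
    exact sub_mem (hs₀deg γ x hx) h1
  · have h1 := hη (x - G' (G x)) (by rw [map_sub, hGG', sub_self])
    change _ = D (-η (x - G' (G x))) + -η (D x - G' (G (D x)))
    rw [hGD, hG'D, ← map_sub, map_neg, ← neg_add, h1, neg_sub]

end HomotopyInverse

section Koszul

variable {R : Type*} [CommRing R] {k : ℕ}

theorem neg_one_pow_card_filter_update (v : Fin k → Bool) (i j : Fin k) :
    (-1 : R) ^ (Finset.univ.filter fun t => t < i ∧ Function.update v j (!v j) t = true).card =
      (if j < i then -1 else 1) *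
        (-1 : R) ^ (Finset.univ.filter fun t => t < i ∧ v t = true).card := by
  simp only [← Finset.prod_const, Finset.prod_filter]
  rw [← Finset.mul_prod_erase _ _ (Finset.mem_univ j),
    ← Finset.mul_prod_erase (a := j) _ _ (Finset.mem_univ j), ← mul_assoc]
  congr 1
  · cases v j <;> by_cases h : j < i <;> simp [h]
  · refine Finset.prod_congr rfl fun t ht => ?_
    rw [Function.update_of_ne (Finset.ne_of_mem_erase ht)]

theorem sum_filter_update {A : Type*} [AddCommGroup A] (f : Fin k → A) (v : Fin k → Bool)
    (i : Fin k) :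
    ∑ j ∈ Finset.univ.filter (fun j => Function.update v i (!v i) j = true), f j =
      ∑ j ∈ Finset.univ.filter (fun j => v j = true), f j + if v i then -f i else f i := by
  simp only [Finset.sum_filter]
  rw [← Finset.add_sum_erase _ _ (Finset.mem_univ i),
    ← Finset.add_sum_erase (a := i) _ (fun j => if v j = true then f j else 0)
      (Finset.mem_univ i),
    Finset.sum_congr rfl fun t ht => by rw [Function.update_of_ne (Finset.ne_of_mem_erase ht)]]
  cases v i <;> simp [add_comm]

theorem koszulDeg_update (dega : Fin k → ℤ) (N : ℕ) (v : Fin k → Bool) (i : Fin k) :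
    koszulDeg dega N (Function.update v i (!v i)) =
      koszulDeg dega N v + if v i then -((N : ℤ) + 1 - dega i) else (N : ℤ) + 1 - dega i :=
  sum_filter_update _ v i

theorem parityK_update (v : Fin k → Bool) (i : Fin k) :
    parityK (Function.update v i (!v i)) = parityK v + 1 := by
  have h := sum_filter_update (fun _ => (1 : ZMod 2)) v i
  simp only [Finset.sum_const, nsmul_eq_mul, mul_one] at h
  rw [parityK, h, parityK]
  congr 1
  cases v i <;> rfl

/-- The Koszul differential as a linear map. -/
noncomputable def koszulLinearMap (S : Type*) [CommRing S] [Algebra S R] (a b : Fin k → R) :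
    ((Fin k → Bool) → R) →ₗ[S] ((Fin k → Bool) → R) where
  toFun := koszulD a b
  map_add' x y := by
    funext v
    simp only [koszulD, Pi.add_apply, mul_add, Finset.sum_add_distrib]
  map_smul' c x := by
    funext v
    simp only [koszulD, Pi.smul_apply, mul_smul_comm, Finset.smul_sum, RingHom.id_apply]

theorem koszulD_koszulD (a b : Fin k → R) (x : (Fin k → Bool) → R) (v : Fin k → Bool) :
    koszulD a b (koszulD a b x) v = (∑ i, a i * b i) * x v := by
  let ε (v : Fin k → Bool) (i : Fin k) : R :=
    (-1 : R) ^ (Finset.univ.filter fun j => j < i ∧ v j = true).card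
  let c (v : Fin k → Bool) (i : Fin k) : R := if v i then a i else b i
  let fl (v : Fin k → Bool) (i : Fin k) : Fin k → Bool := Function.update v i (!v i)
  let F (p : Fin k × Fin k) : R :=
    ε v p.1 * c v p.1 * (ε (fl v p.1) p.2 * c (fl v p.1) p.2 * x (fl (fl v p.1) p.2))
  have hε : ∀ v i j, ε (fl v j) i = (if j < i then -1 else 1) * ε v i :=
    fun v i j => neg_one_pow_card_filter_update v i j
  have hεε : ∀ i, ε v i * ε v i = 1 := fun i => by
    simp only [ε]
    rw [← pow_add, ← two_mul, pow_mul]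
    simp
  have h1 : koszulD a b (koszulD a b x) v = ∑ p : Fin k × Fin k, F p := by
    rw [Fintype.sum_prod_type]
    simp only [F, ← Finset.mul_sum]
    rfl
  have h2 : ∑ p ∈ (Finset.univ : Finset (Fin k)).offDiag, F p = 0 := by
    have hc : ∀ i j, i ≠ j → c (fl v i) j = c v j := fun i j h => by
      simp only [c, fl, Function.update_of_ne h.symm]
    have hfl : ∀ i j, i ≠ j → fl (fl v i) j = fl (fl v j) i := fun i j h => by
      simp only [fl, Function.update_of_ne h, Function.update_of_ne h.symm]
      exact Function.update_comm h _ _ _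
    have hF : ∀ i j, i < j → F (i, j) + F (j, i) = 0 := fun i j h => by
      simp only [F]
      rw [hε, hε, hc i j h.ne, hc j i h.ne', hfl i j h.ne, if_pos h, if_neg h.not_gt]
      ring
    refine Finset.sum_involution (fun p _ => p.swap) ?_ ?_ ?_ ?_
    · rintro ⟨i, j⟩ hp
      rcases lt_or_gt_of_ne (Finset.mem_offDiag.1 hp).2.2 with h | h
      · exact hF i j h
      · rw [add_comm]
        exact hF j i h
    · rintro ⟨i, j⟩ hp - h
      exact (Finset.mem_offDiag.1 hp).2.2 (congrArg Prod.snd h)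
    · rintro ⟨i, j⟩ hp
      simpa [eq_comm] using hp
    · exact fun p _ => p.swap_swap
  rw [h1, ← Finset.univ_product_univ, ← Finset.diag_union_offDiag,
    Finset.sum_union (Finset.disjoint_diag_offDiag _), h2, add_zero, Finset.sum_diag,
    Finset.sum_mul]
  refine Finset.sum_congr rfl fun i _ => ?_
  have h3 : fl (fl v i) i = v := by simp [fl]
  have h4 : c v i * c (fl v i) i = a i * b i := by
    simp only [c, fl, Function.update_self]
    cases v i <;> simp [mul_comm]
  simp only [F]
  rw [hε, if_neg (lt_irrefl i), h3, one_mul, ← h4]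
  linear_combination (c v i * c (fl v i) i * x v) * hεε i

theorem koszulD_sub (a b : Fin k → R) (x y : (Fin k → Bool) → R) :
    koszulD a b (x - y) = koszulD a b x - koszulD a b y :=
  map_sub (koszulLinearMap R a b) x y

theorem koszulD_add (a b : Fin k → R) (x y : (Fin k → Bool) → R) :
    koszulD a b (x + y) = koszulD a b x + koszulD a b y :=
  map_add (koszulLinearMap R a b) x y

theorem koszulD_mem (a b : Fin k → R) (J : Ideal R) {x : (Fin k → Bool) → R} (hx : ∀ v, x v ∈ J)
    (v : Fin k → Bool) : koszulD a b x v ∈ J :=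
  sum_mem fun _ _ => J.mul_mem_left _ (hx _)

/-- One step of the exactness argument: if `b j` is regular modulo `I`, where `I` contains the
previous `b i`, then cycles modulo `I` can be corrected by boundaries so that they vanish
modulo `I` instead of `(I, b j)`. -/
theorem exists_sub_koszulD_mem (a b : Fin k → R) (I : Ideal R) (j : Fin k)
    (hlt : ∀ i < j, b i ∈ I) (hreg : ∀ c, b j * c ∈ I → c ∈ I) (x : (Fin k → Bool) → R)
    (hx : ∀ v, (∀ i ≤ j, v i = false) → x v ∈ I ⊔ Ideal.span {b j})
    (hDx : ∀ v, (∀ i < j, v i = false) → koszulD a b x v ∈ I) :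
    ∃ y : (Fin k → Bool) → R, (∀ v, (∀ i ≤ j, v i = false) → y v = 0) ∧
      ∀ v, (∀ i < j, v i = false) → x v - koszulD a b y v ∈ I := by
  classical
  have hc : ∀ v : Fin k → Bool, ∃ c, (∀ i ≤ j, v i = false) →
      Ideal.Quotient.mk I (x v) = Ideal.Quotient.mk I (b j) * Ideal.Quotient.mk I c := by
    intro v
    by_cases h : ∀ i ≤ j, v i = false
    · obtain ⟨s, hs, t, ht, hst⟩ := Submodule.mem_sup.1 (hx v h)
      obtain ⟨c, rfl⟩ := Ideal.mem_span_singleton'.1 ht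
      refine ⟨c, fun _ => ?_⟩
      rw [← hst, map_add, Ideal.Quotient.eq_zero_iff_mem.2 hs, zero_add, map_mul, mul_comm]
    · exact ⟨0, fun h' => absurd h' h⟩
  choose c hc using hc
  let y (v : Fin k → Bool) : R :=
    if (∀ i < j, v i = false) ∧ v j = true then c (Function.update v j false) else 0
  have hy0 : ∀ v, v j = false → y v = 0 := fun v h => if_neg (by simp [h])
  have hy1 : ∀ v, (∀ i < j, v i = false) → v j = true → y v = c (Function.update v j false) :=
    fun v h h' => if_pos ⟨h, h'⟩
  have hb : ∀ i < j, Ideal.Quotient.mk I (b i) = 0 :=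
    fun i hi => Ideal.Quotient.eq_zero_iff_mem.2 (hlt i hi)
  have hsign : ∀ v : Fin k → Bool, (∀ i < j, v i = false) →
      (Finset.univ.filter fun t => t < j ∧ v t = true).card = 0 := fun v hv => by
    rw [Finset.card_eq_zero, Finset.filter_eq_empty_iff]
    rintro t - ⟨h, h'⟩
    simp [hv t h] at h'
  refine ⟨y, fun v hv => hy0 v (hv j le_rfl), fun v hv => ?_⟩
  cases hvj : v j with
  | false =>
    have hv' : ∀ i ≤ j, v i = false := fun i hi => by
      rcases hi.lt_or_eq with h | rfl
      exacts [hv i h, hvj]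
    rw [← Ideal.Quotient.eq, hc v hv', koszulD, map_sum, Finset.sum_eq_single j]
    · rw [hsign v hv, hvj, hy1 _ (fun i hi => by rw [Function.update_of_ne hi.ne, hv i hi])
        (by simp), Function.update_idem, Function.update_eq_self_iff.2 hvj.symm]
      simp
    · intro i _ hij
      rcases lt_or_gt_of_ne hij with h | h
      · simp [hv i h, hb i h]
      · rw [hy0 _ (by rw [Function.update_of_ne h.ne, hvj]), mul_zero, map_zero]
    · exact fun h => absurd (Finset.mem_univ j) h
  | true =>
    refine hreg _ ?_
    let u := Function.update v j (!v j)
    have hu : ∀ i ≤ j, u i = false := fun i hi => by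
      rcases hi.lt_or_eq with h | rfl
      · simp only [u, Function.update_of_ne h.ne, hv i h]
      · simp [u, hvj]
    have hDu := Ideal.Quotient.eq_zero_iff_mem.2 (hDx u fun i hi => hu i hi.le)
    rw [← Ideal.Quotient.eq_zero_iff_mem, mul_sub, map_sub, sub_eq_zero,
      ← add_zero (Ideal.Quotient.mk I (b j * koszulD a b y v)), ← hDu, koszulD, koszulD,
      Finset.mul_sum, map_sum, map_sum, ← Finset.sum_add_distrib, Finset.sum_eq_single j]
    · have hujv : Function.update u j (!u j) = v := by simp [u, hvj]
      rw [hujv, hsign u (fun i hi => hu i hi.le), hu j le_rfl, hy0 _ (by simp [hvj])]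
      simp
    · intro i _ hij
      rcases lt_or_gt_of_ne hij with h | h
      · simp [hv i h, hu i h.le, hb i h]
      · have huv : Function.update (Function.update v i (!v i)) j false =
            Function.update u i (!u i) := by
          simp only [u, hvj, Function.update_of_ne hij]
          exact Function.update_comm hij _ _ _
        have hui : u i = v i := by simp only [u, Function.update_of_ne hij]
        have hs := neg_one_pow_card_filter_update (R := R) v i j
        rw [if_pos h] at hs
        rw [hy1 _ (fun t ht => by rw [Function.update_of_ne (ht.trans h).ne, hv t ht])
          (by rw [Function.update_of_ne h.ne, hvj]), huv]
        simp only [map_mul]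
        rw [hc (Function.update u i (!u i)) (fun t ht => by
          rw [Function.update_of_ne (ht.trans_lt h).ne, hu t ht]), hui, hs]
        simp only [map_mul, map_neg, map_one]
        ring
    · exact fun h => absurd (Finset.mem_univ j) h

/-- If `b 0, …, b (l - 1)` is a regular sequence modulo `J`, then the kernel of the projection of
the Koszul factorization onto its quotient by `b 0, …, b (l - 1)` is exact modulo `J`. -/
theorem exists_sub_koszulD_mem_of_regular (a b : Fin k → R) (J : Ideal R)
    (hw : ∑ i, a i * b i ∈ J) (l : ℕ)
    (hreg : ∀ i : Fin k, (i : ℕ) < l → ∀ c, b i * c ∈ J ⊔ Ideal.span (b '' {u | u < i}) →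
      c ∈ J ⊔ Ideal.span (b '' {u | u < i})) (hl : l ≤ k) (x : (Fin k → Bool) → R)
    (hx : ∀ v, (∀ i : Fin k, (i : ℕ) < l → v i = false) →
      x v ∈ J ⊔ Ideal.span (b '' {u | (u : ℕ) < l}))
    (hDx : ∀ v, koszulD a b x v ∈ J) :
    ∃ y : (Fin k → Bool) → R, (∀ v, (∀ i : Fin k, (i : ℕ) < l → v i = false) → y v = 0) ∧
      ∀ v, x v - koszulD a b y v ∈ J := by
  induction l generalizing x with
  | zero =>
    refine ⟨0, fun _ _ => rfl, fun v => ?_⟩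
    have h := koszulD_mem a b ⊥ (x := 0) (fun _ => zero_mem _) v
    rw [(Submodule.mem_bot R).1 h, sub_zero]
    simpa using hx v
  | succ l ih =>
    let j : Fin k := ⟨l, hl⟩
    obtain ⟨y₁, hy₁, hxy₁⟩ := exists_sub_koszulD_mem a b
      (J ⊔ Ideal.span (b '' {u | u < j})) j
      (fun i hi => Ideal.mem_sup_right (Ideal.subset_span ⟨i, hi, rfl⟩))
      (hreg j l.lt_succ_self) x
      (fun v hv => by
        have h := hx v fun i hi => hv i (Nat.lt_succ_iff.1 hi)
        have hs : {u : Fin k | (u : ℕ) < l + 1} = {u | u < j} ∪ {j} := by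
          ext u
          simp only [Set.mem_ofPred_eq, Set.mem_union, Set.mem_singleton_iff, Fin.lt_def, Fin.ext_iff,
            j]
          omega
        rwa [hs, Set.image_union, Set.image_singleton, Ideal.span_union, ← sup_assoc] at h)
      (fun v _ => Ideal.mem_sup_left (hDx v))
    obtain ⟨y₂, hy₂, hxy₂⟩ := ih (fun i hi => hreg i (hi.trans l.lt_succ_self))
      (Nat.le_of_succ_le hl) (x - koszulD a b y₁) (fun v hv => hxy₁ v fun i hi => hv i hi)
      (fun v => by
        rw [koszulD_sub, Pi.sub_apply, koszulD_koszulD]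
        exact sub_mem (hDx v) (J.mul_mem_right _ hw))
    refine ⟨y₁ + y₂, fun v hv => ?_, fun v => ?_⟩
    · rw [Pi.add_apply, hy₁ v fun i hi => hv i (Nat.lt_succ_iff.2 hi),
        hy₂ v fun i hi => hv i (hi.trans l.lt_succ_self), add_zero]
    · rw [koszulD_add, Pi.add_apply, ← sub_sub]
      exact hxy₂ v

end Koszul

section Append

variable {l r : ℕ}

theorem sum_filter_append_false {A : Type*} [AddCommMonoid A] (f : Fin (l + r) → A)
    (v : Fin r → Bool) :
    ∑ i ∈ Finset.univ.filter (fun i => Fin.append (fun _ : Fin l => false) v i = true), f i =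
      ∑ i ∈ Finset.univ.filter (fun i => v i = true), f (Fin.natAdd l i) := by
  simp [Finset.sum_filter, Fin.sum_univ_add]

theorem koszulDeg_append_false (dega : Fin (l + r) → ℤ) (N : ℕ) (v : Fin r → Bool) :
    koszulDeg dega N (Fin.append (fun _ : Fin l => false) v) =
      koszulDeg (fun t => dega (Fin.natAdd l t)) N v :=
  sum_filter_append_false _ v

theorem parityK_append_false (v : Fin r → Bool) :
    parityK (Fin.append (fun _ : Fin l => false) v) = parityK v := by
  have h := sum_filter_append_false (l := l) (fun _ => (1 : ZMod 2)) v
  simpa [parityK] using h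

theorem update_append_natAdd (u : Fin l → Bool) (v : Fin r → Bool) (t : Fin r) (z : Bool) :
    Function.update (Fin.append u v) (Fin.natAdd l t) z =
      Fin.append u (Function.update v t z) := by
  funext i
  induction i using Fin.addCases with
  | left i =>
    rw [Function.update_of_ne (by simp [Fin.ext_iff]; omega), Fin.append_left, Fin.append_left]
  | right i =>
    rw [Fin.append_right]
    by_cases h : i = t
    · subst h
      simp
    · rw [Function.update_of_ne h, Function.update_of_ne (by simpa [Fin.ext_iff] using h),
        Fin.append_right]

/-- A vector whose first entries are `false` is obtained by appending. -/
theorem eq_append_false {v : Fin (l + r) → Bool}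
    (h : ∀ i : Fin (l + r), (i : ℕ) < l → v i = false) :
    v = Fin.append (fun _ : Fin l => false) fun t => v (Fin.natAdd l t) := by
  funext i
  induction i using Fin.addCases with
  | left i => rw [Fin.append_left, h _ (by simp)]
  | right i => rw [Fin.append_right]

variable {R : Type*} [CommRing R]

/-- The quotient map of Koszul factorizations is compatible with the differentials. -/
theorem mk_koszulD_append_false (a b : Fin (l + r) → R) (I : Ideal R)
    (hb : ∀ i : Fin l, b (Fin.castAdd r i) ∈ I) (x : (Fin (l + r) → Bool) → R)
    (v : Fin r → Bool) :
    Ideal.Quotient.mk I (koszulD a b x (Fin.append (fun _ => false) v)) =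
      koszulD (fun t : Fin r => Ideal.Quotient.mk I (a (Fin.natAdd l t)))
        (fun t : Fin r => Ideal.Quotient.mk I (b (Fin.natAdd l t)))
        (fun v => Ideal.Quotient.mk I (x (Fin.append (fun _ => false) v))) v := by
  have hcard : ∀ t : Fin r, (Finset.univ.filter fun j : Fin (l + r) =>
      j < Fin.natAdd l t ∧ Fin.append (fun _ : Fin l => false) v j = true).card =
        (Finset.univ.filter fun j => j < t ∧ v j = true).card := fun t => by
    simp only [Finset.card_filter, Fin.sum_univ_add]
    simp
  simp only [koszulD, map_sum]
  rw [Fin.sum_univ_add, Finset.sum_eq_zero, zero_add]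
  · refine Finset.sum_congr rfl fun t _ => ?_
    rw [hcard, update_append_natAdd, Fin.append_right]
    cases v t <;> simp
  · intro i _
    simp [Ideal.Quotient.eq_zero_iff_mem.2 (hb i)]

/-- Extension by zero from the vectors whose first entries are `false`. -/
theorem exists_extend_append_false (z : (Fin r → Bool) → R) :
    ∃ x : (Fin (l + r) → Bool) → R, (∀ v, x (Fin.append (fun _ => false) v) = z v) ∧
      ∀ u, x u = 0 ∨ ∃ v, u = Fin.append (fun _ => false) v := by
  classical
  refine ⟨fun u => if ∀ i : Fin (l + r), (i : ℕ) < l → u i = false then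
    z fun t => u (Fin.natAdd l t) else 0, fun v => ?_, fun u => ?_⟩
  · refine (if_pos fun i hi => ?_).trans (by simp)
    have h : i = Fin.castAdd r ⟨i, hi⟩ := rfl
    rw [h, Fin.append_left]
  · by_cases h : ∀ i : Fin (l + r), (i : ℕ) < l → u i = false
    · exact Or.inr ⟨_, eq_append_false h⟩
    · exact Or.inl (if_neg h)

end Append

theorem mem_smul_top_pi_iff {S R ι : Type*} [CommRing S] [CommRing R] [Algebra S R] [Fintype ι]
    (𝔪 : Ideal S) (x : ι → R) :
    x ∈ 𝔪 • (⊤ : Submodule S (ι → R)) ↔ ∀ v, x v ∈ 𝔪.map (algebraMap S R) := by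
  classical
  have key : ∀ y : R, y ∈ 𝔪 • (⊤ : Submodule S R) ↔ y ∈ 𝔪.map (algebraMap S R) := fun y => by
    rw [Ideal.smul_top_eq_map]
    rfl
  refine ⟨fun hx v => ?_, fun hx => ?_⟩
  · rw [← key]
    have h := Submodule.mem_map_of_mem (f := LinearMap.proj (R := S) v) hx
    rw [Submodule.map_smul''] at h
    exact Submodule.smul_mono le_rfl le_top h
  · rw [← Finset.univ_sum_single x]
    refine sum_mem fun v _ => ?_
    have h := Submodule.mem_map_of_mem (f := LinearMap.single S (fun _ : ι => R) v)
      ((key _).2 (hx v))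
    rw [Submodule.map_smul''] at h
    exact Submodule.smul_mono le_rfl le_top h

section PiGrading

open DirectSum

variable {k R ι : Type*} [CommRing k] [CommRing R] [Algebra k R] (ℛ : ℤ → Submodule k R)
  (d : ι → ℤ) (c : ι → ZMod 2)

/-- The grading by degree and parity on the free module over a graded ring with basis elements
`e v` of degree `d v` and parity `c v`. -/
def piGrading (γ : ℤ × ZMod 2) : Submodule k (ι → R) where
  carrier := {x | ∀ v, x v ∈ ℛ (γ.1 - d v) ∧ (c v ≠ γ.2 → x v = 0)}
  add_mem' hx hy v := ⟨add_mem (hx v).1 (hy v).1, fun h => by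
    rw [Pi.add_apply, (hx v).2 h, (hy v).2 h, add_zero]⟩
  zero_mem' _ := ⟨zero_mem _, fun _ => rfl⟩
  smul_mem' s x hx v := ⟨Submodule.smul_mem _ s (hx v).1, fun h => by
    rw [Pi.smul_apply, (hx v).2 h, smul_zero]⟩

variable {ℛ d c} in
theorem single_mem_piGrading [DecidableEq ι] {γ : ℤ × ZMod 2} {x : ι → R}
    (hx : x ∈ piGrading ℛ d c γ) (v : ι) : Pi.single v (x v) ∈ piGrading ℛ d c γ := fun u => by
  by_cases h : u = v
  · subst h
    simpa using hx u
  · simp [h]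

/-- The inclusion of the summand spanned by a basis element, on a homogeneous piece. -/
def piGradingSingle [DecidableEq ι] (v : ι) (g : ℤ) :
    ℛ g →ₗ[k] piGrading ℛ d c (g + d v, c v) :=
  (LinearMap.single k (fun _ : ι => R) v ∘ₗ (ℛ g).subtype).codRestrict _ fun x u => by
    by_cases h : u = v
    · subst h
      simp
    · simp [h]

theorem lof_piGradingSingle [DecidableEq ι] {γ : ℤ × ZMod 2} {x : ι → R}
    (hx : x ∈ piGrading ℛ d c γ) (v : ι) :
    lof k (ℤ × ZMod 2) (fun γ => piGrading ℛ d c γ) (γ.1 - d v + d v, c v)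
      (piGradingSingle ℛ d c v (γ.1 - d v) ⟨x v, (hx v).1⟩) =
    lof k (ℤ × ZMod 2) (fun γ => piGrading ℛ d c γ) γ
      ⟨Pi.single v (x v), single_mem_piGrading hx v⟩ := by
  by_cases h : c v = γ.2
  · have hγ : (γ.1 - d v + d v, c v) = γ := Prod.ext (sub_add_cancel _ _) h
    exact DirectSum.of_eq_of_gradedMonoid_eq (Sigma.subtype_ext hγ rfl)
  · have h0 := (hx v).2 h
    have h1 : (⟨x v, (hx v).1⟩ : ℛ (γ.1 - d v)) = 0 := Subtype.ext h0
    have h2 : (⟨Pi.single v (x v), single_mem_piGrading hx v⟩ : piGrading ℛ d c γ) = 0 :=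
      Subtype.ext ((congrArg (Pi.single v) h0).trans (Pi.single_zero v))
    rw [h1, h2, map_zero, map_zero, map_zero]

variable [GradedAlgebra ℛ]

/-- The decomposition of the free module into pieces of given degree and parity. -/
noncomputable instance piGradingDecomposition [Fintype ι] [DecidableEq ι] :
    Decomposition (piGrading ℛ d c) :=
  Decomposition.ofLinearMap (piGrading ℛ d c)
    (∑ v : ι, toModule k ℤ _ (fun g => lof k (ℤ × ZMod 2) (fun γ => piGrading ℛ d c γ)
        (g + d v, c v) ∘ₗ piGradingSingle ℛ d c v g) ∘ₗ
      (decomposeLinearEquiv ℛ).toLinearMap ∘ₗ LinearMap.proj v)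
    (by
      refine LinearMap.ext fun x => ?_
      simp only [LinearMap.comp_apply, LinearMap.sum_apply, map_sum, LinearMap.id_apply]
      conv_rhs => rw [← Finset.univ_sum_single x]
      refine Finset.sum_congr rfl fun v _ => ?_
      generalize hy : LinearMap.proj (R := k) v x = y
      have hy' : x v = y := hy
      rw [hy']
      clear hy hy'
      induction y using Decomposition.inductionOn ℛ with
      | zero => simp
      | @homogeneous g m =>
        simp only [LinearEquiv.coe_coe, decomposeLinearEquiv_apply, decompose_coe]
        rw [← lof_eq_of k, toModule_lof]
        simp only [LinearMap.comp_apply, coeLinearMap_lof]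
        rfl
      | add m m' hm hm' => simp only [map_add, hm, hm', Pi.single_add])
    (by
      ext γ x : 2
      simp only [LinearMap.comp_apply, LinearMap.sum_apply, LinearMap.id_apply,
        coeLinearMap_lof, LinearEquiv.coe_coe, decomposeLinearEquiv_apply, LinearMap.proj_apply]
      have h (v : ι) : decompose ℛ ((x : ι → R) v) =
          lof k ℤ (fun g => ℛ g) (γ.1 - d v) ⟨(x : ι → R) v, (x.2 v).1⟩ :=
        decompose_of_mem ℛ _
      simp only [h, toModule_lof, LinearMap.comp_apply, lof_piGradingSingle ℛ d c x.2]
      rw [← map_sum]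
      congr 1
      refine Subtype.ext ?_
      rw [Submodule.coe_sum]
      exact Finset.univ_sum_single (x : ι → R))

theorem decompose_piGrading_apply [Fintype ι] [DecidableEq ι] (x : ι → R) (γ : ℤ × ZMod 2)
    (v : ι) : (decompose (piGrading ℛ d c) x γ : ι → R) v =
      if c v = γ.2 then (decompose ℛ (x v) (γ.1 - d v) : R) else 0 := by
  induction x using Decomposition.inductionOn (piGrading ℛ d c) with
  | zero => simp
  | @homogeneous δ m =>
    by_cases h : δ = γ
    · subst h
      rw [decompose_of_mem_same _ m.2]
      split_ifs with h
      · rw [decompose_of_mem_same ℛ (m.2 v).1]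
      · exact (m.2 v).2 h
    · rw [decompose_of_mem_ne _ m.2 h]
      split_ifs with h'
      · by_cases h1 : δ.1 = γ.1
        · have h2 : c v ≠ δ.2 := fun h2 => h (Prod.ext h1 (h2.symm.trans h'))
          rw [(m.2 v).2 h2]
          simp
        · rw [decompose_of_mem_ne ℛ (m.2 v).1 fun h2 => h1 (sub_left_injective h2)]
          rfl
      · rfl
  | add m m' hm hm' =>
    simp only [decompose_add, DirectSum.add_apply, Submodule.coe_add, Pi.add_apply, hm, hm']
    split_ifs <;> simp

end PiGrading

section NicePair

theorem mk_mem_span_image_iff {R ι : Type*} [CommRing R] (J : Ideal R) (f : ι → R) (s : Set ι)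
    (c : R) : Ideal.Quotient.mk J c ∈ Ideal.span ((fun u => Ideal.Quotient.mk J (f u)) '' s) ↔
      c ∈ J ⊔ Ideal.span (f '' s) := by
  rw [← Set.image_image (Ideal.Quotient.mk J) f s, ← Ideal.map_span,
    Ideal.mem_quotient_iff_mem_sup, sup_comm]

theorem image_castAdd_Iio {α : Type*} {l r : ℕ} (b : Fin (l + r) → α) (i : Fin l) :
    (fun u : Fin l => b (Fin.castAdd r u)) '' {u | u < i} =
      b '' {u | u < Fin.castAdd r i} := by
  ext y
  constructor
  · rintro ⟨u, hu, rfl⟩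
    exact ⟨_, hu, rfl⟩
  · rintro ⟨u, hu, rfl⟩
    exact ⟨⟨u, lt_trans (Fin.lt_def.1 hu) i.2⟩, hu, rfl⟩

theorem range_castAdd {α : Type*} {l r : ℕ} (b : Fin (l + r) → α) :
    (Set.range fun u : Fin l => b (Fin.castAdd r u)) = b '' {u | (u : ℕ) < l} := by
  ext y
  constructor
  · rintro ⟨u, rfl⟩
    exact ⟨_, u.2, rfl⟩
  · rintro ⟨u, hu, rfl⟩
    exact ⟨⟨u, hu⟩, rfl⟩

/-- A polynomial whose image in a graded algebra is homogeneous of nonzero degree maps into the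
ideal generated by the variables. -/
theorem algebraMap_mem_map_idealOfVars {k σ R : Type*} [CommRing k] [CommRing R] [Algebra k R]
    [Algebra (MvPolynomial σ k) R] [IsScalarTower k (MvPolynomial σ k) R]
    (ℛ : ℤ → Submodule k R) [GradedAlgebra ℛ]
    (hJ : ((idealOfVars σ k).map (algebraMap (MvPolynomial σ k) R)).IsHomogeneous ℛ)
    {g : ℤ} (hg : g ≠ 0) (w : MvPolynomial σ k) (hw : algebraMap _ R w ∈ ℛ g) :
    algebraMap _ R w ∈ (idealOfVars σ k).map (algebraMap (MvPolynomial σ k) R) := by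
  have h := Ideal.mem_map_of_mem (algebraMap (MvPolynomial σ k) R)
    (sub_C_constantCoeff_mem_idealOfVars w)
  have hC : algebraMap (MvPolynomial σ k) R (C (constantCoeff w)) ∈ ℛ 0 := by
    rw [← algebraMap_eq, ← IsScalarTower.algebraMap_apply]
    exact SetLike.algebraMap_mem_graded ℛ _
  have h0 := hJ 0 h
  rw [map_sub, DirectSum.decompose_sub, DirectSum.sub_apply, Submodule.coe_sub,
    DirectSum.decompose_of_mem_ne ℛ hw hg, DirectSum.decompose_of_mem_same ℛ hC] at h0
  rw [map_sub] at h
  have h1 := sub_mem h h0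
  simpa using h1

end NicePair

section KoszulGrading

variable {k R : Type*} [CommRing k] [CommRing R] [Algebra k R] (ℛ : ℤ → Submodule k R)
  [GradedAlgebra ℛ]

/-- The Koszul differential is homogeneous of degree `N + 1` and odd. -/
theorem koszulD_mem_piGrading {m : ℕ} {a b : Fin m → R} {dega degb : Fin m → ℤ} {N : ℕ}
    (ha : ∀ i, a i ∈ ℛ (dega i)) (hb : ∀ i, b i ∈ ℛ (degb i))
    (hdeg : ∀ i, dega i + degb i = 2 * (N : ℤ) + 2) {γ : ℤ × ZMod 2} {x : (Fin m → Bool) → R}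
    (hx : x ∈ piGrading ℛ (koszulDeg dega N) parityK γ) :
    koszulD a b x ∈ piGrading ℛ (koszulDeg dega N) parityK (γ + ((N : ℤ) + 1, 1)) := by
  refine fun v => ⟨sum_mem fun i _ => ?_, fun hv => Finset.sum_eq_zero fun i _ => ?_⟩
  · have h1 := (hx (Function.update v i (!v i))).1
    rw [koszulDeg_update] at h1
    have h2 : (if v i then a i else b i) * x (Function.update v i (!v i)) ∈
        ℛ ((γ + ((N : ℤ) + 1, 1)).1 - koszulDeg dega N v) := by
      have hi := hdeg i
      cases hvi : v i with
      | true =>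
        simp only [hvi, if_true] at h1 ⊢
        convert SetLike.mul_mem_graded (ha i) h1 using 2
        rw [Prod.fst_add]
        dsimp only
        ring
      | false =>
        simp only [hvi, Bool.false_eq_true, if_false] at h1 ⊢
        convert SetLike.mul_mem_graded (hb i) h1 using 2
        rw [Prod.fst_add]
        dsimp only
        linarith
    rw [mul_assoc]
    rcases neg_one_pow_eq_or R
      (Finset.univ.filter fun j => j < i ∧ v j = true).card with h | h <;> rw [h]
    · rwa [one_mul]
    · rw [neg_one_mul]
      exact neg_mem h2
  · rw [(hx _).2, mul_zero]
    rw [parityK_update]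
    intro h
    refine hv ?_
    rw [Prod.snd_add, ← h, add_assoc]
    exact (add_zero _).symm

end KoszulGrading

theorem koszul_contraction_nice_pair_b
    (N : ℕ) (hN : 2 ≤ N) (n : ℕ) (wtn : Fin n → ℕ) (hwtn : ∀ i, 0 < wtn i)
    (R : Type*) [CommRing R] [Algebra ℂ R] [Algebra (MvPolynomial (Fin n) ℂ) R]
    [IsScalarTower ℂ (MvPolynomial (Fin n) ℂ) R]
    (ℛ : ℤ → Submodule ℂ R) [GradedAlgebra ℛ]
    (hinj : Function.Injective (algebraMap (MvPolynomial (Fin n) ℂ) R))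
    (hgrmap : ∀ (p : MvPolynomial (Fin n) ℂ) (d : ℤ),
      p.IsWeightedHomogeneous (fun i => (wtn i : ℤ)) d →
        algebraMap (MvPolynomial (Fin n) ℂ) R p ∈ ℛ d)
    (l r : ℕ) (hl : 1 ≤ l)
    (a b : Fin (l + r) → R) (dega degb : Fin (l + r) → ℤ)
    (ha : ∀ i, a i ∈ ℛ (dega i)) (hb : ∀ i, b i ∈ ℛ (degb i))
    (hdeg : ∀ i, dega i + degb i = 2 * (N : ℤ) + 2)
    (w : MvPolynomial (Fin n) ℂ)
    (hpot : ∑ i, a i * b i = algebraMap (MvPolynomial (Fin n) ℂ) R w)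
    -- `(R, {b_1,…,b_l})` is a nice pair over `R̂`:
    (hfree : Module.Free (MvPolynomial (Fin n) ℂ) R)
    (hbddbelow : ∃ g₀ : ℤ, ∀ g < g₀, ℛ g = ⊥)
    (I : Ideal R) (hI : I = Ideal.span (Set.range fun i : Fin l => b (Fin.castAdd r i)))
    (hqfree : Module.Free (MvPolynomial (Fin n) ℂ) (R ⧸ I))
    (hqgraded : DirectSum.IsInternal
      (fun g : ℤ => (ℛ g).map (Ideal.Quotient.mkₐ ℂ I).toLinearMap))
    (J : Ideal R) (hJ : J = Ideal.span (Set.range fun t : Fin n =>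
      algebraMap (MvPolynomial (Fin n) ℂ) R (MvPolynomial.X t)))
    (hregular :
      Ideal.span (Set.range fun i : Fin l =>
          Ideal.Quotient.mk J (b (Fin.castAdd r i))) ≠ ⊤ ∧
        ∀ (i : Fin l) (x : R ⧸ J),
          Ideal.Quotient.mk J (b (Fin.castAdd r i)) * x ∈
              Ideal.span ((fun u : Fin l => Ideal.Quotient.mk J (b (Fin.castAdd r u))) ''
                {u : Fin l | u < i}) →
            x ∈ Ideal.span ((fun u : Fin l => Ideal.Quotient.mk J (b (Fin.castAdd r u))) ''
              {u : Fin l | u < i})) :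
    -- conclusion: homotopy equivalence of graded matrix factorizations over `R̂`
    ∃ (G : ((Fin (l + r) → Bool) → R) →ₗ[MvPolynomial (Fin n) ℂ]
        ((Fin r → Bool) → R ⧸ I))
      (G' : ((Fin r → Bool) → R ⧸ I) →ₗ[MvPolynomial (Fin n) ℂ]
        ((Fin (l + r) → Bool) → R)),
      (∀ x, G (koszulD a b x) =
        koszulD (fun t : Fin r => Ideal.Quotient.mk I (a (Fin.natAdd l t)))
          (fun t : Fin r => Ideal.Quotient.mk I (b (Fin.natAdd l t))) (G x)) ∧
      (∀ y, G' (koszulD (fun t : Fin r => Ideal.Quotient.mk I (a (Fin.natAdd l t)))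
          (fun t : Fin r => Ideal.Quotient.mk I (b (Fin.natAdd l t))) y) =
        koszulD a b (G' y)) ∧
      (∀ (c : ZMod 2) (x : (Fin (l + r) → Bool) → R),
        (∀ v, parityK v ≠ c → x v = 0) → ∀ v', parityK v' ≠ c → G x v' = 0) ∧
      (∀ (c : ZMod 2) (y : (Fin r → Bool) → R ⧸ I),
        (∀ v', parityK v' ≠ c → y v' = 0) → ∀ v, parityK v ≠ c → G' y v = 0) ∧
      (∀ g : ℤ, ∀ x ∈ DegSet ℛ dega N g,
        G x ∈ DegSet (fun gg : ℤ => (ℛ gg).map (Ideal.Quotient.mkₐ ℂ I).toLinearMap)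
          (fun t : Fin r => dega (Fin.natAdd l t)) N g) ∧
      (∀ g : ℤ, ∀ y ∈ DegSet (fun gg : ℤ => (ℛ gg).map (Ideal.Quotient.mkₐ ℂ I).toLinearMap)
          (fun t : Fin r => dega (Fin.natAdd l t)) N g,
        G' y ∈ DegSet ℛ dega N g) ∧
      (∃ h : ((Fin (l + r) → Bool) → R) →ₗ[MvPolynomial (Fin n) ℂ]
          ((Fin (l + r) → Bool) → R),
        ∀ x, G' (G x) - x = koszulD a b (h x) + h (koszulD a b x)) ∧
      (∃ h' : ((Fin r → Bool) → R ⧸ I) →ₗ[MvPolynomial (Fin n) ℂ]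
          ((Fin r → Bool) → R ⧸ I),
        ∀ y, G (G' y) - y =
          koszulD (fun t : Fin r => Ideal.Quotient.mk I (a (Fin.natAdd l t)))
              (fun t : Fin r => Ideal.Quotient.mk I (b (Fin.natAdd l t))) (h' y) +
            h' (koszulD (fun t : Fin r => Ideal.Quotient.mk I (a (Fin.natAdd l t)))
              (fun t : Fin r => Ideal.Quotient.mk I (b (Fin.natAdd l t))) y)) := by
  classical
  have hJ' : J = (idealOfVars (Fin n) ℂ).map (algebraMap (MvPolynomial (Fin n) ℂ) R) := by
    rw [hJ, idealOfVars, Ideal.map_span, ← Set.range_comp]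
    rfl
  have hXR (t : Fin n) : algebraMap (MvPolynomial (Fin n) ℂ) R (X t) ∈ ℛ (wtn t) :=
    hgrmap _ _ (isWeightedHomogeneous_X ℂ _ t)
  have hJhom : J.IsHomogeneous ℛ := by
    rw [hJ]
    refine Ideal.homogeneous_span ℛ _ ?_
    rintro _ ⟨t, rfl⟩
    exact ⟨_, hXR t⟩
  have hIhom : I.IsHomogeneous ℛ := by
    rw [hI]
    refine Ideal.homogeneous_span ℛ _ ?_
    rintro _ ⟨i, rfl⟩
    exact ⟨_, hb _⟩
  have hbI (i : Fin l) : b (Fin.castAdd r i) ∈ I := hI ▸ Ideal.subset_span ⟨i, rfl⟩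
  have hwJ : algebraMap (MvPolynomial (Fin n) ℂ) R w ∈ J := by
    have hwdeg : algebraMap (MvPolynomial (Fin n) ℂ) R w ∈ ℛ (2 * (N : ℤ) + 2) := by
      rw [← hpot]
      exact sum_mem fun i _ => hdeg i ▸ SetLike.mul_mem_graded (ha i) (hb i)
    rw [hJ'] at hJhom ⊢
    exact algebraMap_mem_map_idealOfVars ℛ hJhom (by omega) w hwdeg
  have hmem {m : ℕ} (x : (Fin m → Bool) → R) :
      x ∈ idealOfVars (Fin n) ℂ • (⊤ : Submodule (MvPolynomial (Fin n) ℂ) ((Fin m → Bool) → R)) ↔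
        ∀ v, x v ∈ J := by
    rw [hJ']
    exact mem_smul_top_pi_iff _ x
  let G : ((Fin (l + r) → Bool) → R) →ₗ[MvPolynomial (Fin n) ℂ] ((Fin r → Bool) → R ⧸ I) :=
    { toFun := fun x v => Ideal.Quotient.mk I (x (Fin.append (fun _ => false) v))
      map_add' := fun x y => rfl
      map_smul' := fun p x => rfl }
  have hG (z : (Fin r → Bool) → R) (x : (Fin (l + r) → Bool) → R)
      (hx : ∀ v, x (Fin.append (fun _ => false) v) = z v) :
      G x = fun v => Ideal.Quotient.mk I (z v) := funext fun v => congrArg _ (hx v)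
  have hG0 (x : (Fin (l + r) → Bool) → R) :
      G x = 0 ↔ ∀ v, x (Fin.append (fun _ => false) v) ∈ I :=
    funext_iff.trans (forall_congr' fun v => Ideal.Quotient.eq_zero_iff_mem)
  obtain ⟨g₀, hg₀⟩ := hbddbelow
  obtain ⟨e, he⟩ := (Set.finite_range (koszulDeg dega N)).bddBelow
  obtain ⟨G', hGG', hG'D, hG'deg, h, hh⟩ := exists_homogeneous_homotopy_inverse
    (ℳ := piGrading ℛ (koszulDeg dega N) parityK) (wt := fun t => ((wtn t : ℤ), 0))
    (fun t γ x hx v => ⟨by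
      rw [Pi.smul_apply, Algebra.smul_def]
      convert SetLike.mul_mem_graded (hXR t) (hx v).1 using 2
      rw [Prod.fst_add]
      dsimp only
      ring, fun hv => by
      rw [Pi.smul_apply, (hx v).2 (by simpa using hv), smul_zero]⟩)
    (AddMonoidHom.fst ℤ (ZMod 2)) (fun t => Int.natCast_pos.2 (hwtn t)) (g₀ + e)
    (fun γ hγ => by
      refine (Submodule.eq_bot_iff _).2 fun x hx => funext fun v => ?_
      have h1 : γ.1 < g₀ + e := hγ
      have h2 : e ≤ koszulDeg dega N v := he ⟨v, rfl⟩
      have h3 := (hx v).1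
      rwa [hg₀ _ (by linarith), Submodule.mem_bot] at h3)
    (koszulLinearMap (MvPolynomial (Fin n) ℂ) a b)
    (koszulLinearMap (MvPolynomial (Fin n) ℂ)
      (fun t : Fin r => Ideal.Quotient.mk I (a (Fin.natAdd l t)))
      (fun t : Fin r => Ideal.Quotient.mk I (b (Fin.natAdd l t))))
    G
    (fun y => by
      obtain ⟨x, hx, -⟩ := exists_extend_append_false (l := l) fun v => (y v).out
      exact ⟨x, (hG _ x hx).trans (funext fun v => Ideal.Quotient.mk_out (y v))⟩)
    (fun x => funext fun v => mk_koszulD_append_false a b I hbI x v)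
    (fun x hx γ => by
      rw [hG0] at hx ⊢
      intro v
      rw [decompose_piGrading_apply]
      split_ifs
      · exact hIhom _ (hx v)
      · exact zero_mem I)
    ((N : ℤ) + 1, 1) (fun γ x hx => koszulD_mem_piGrading ℛ ha hb hdeg hx) w
    (fun x => funext fun v => (koszulD_koszulD a b x v).trans
      (by rw [hpot, Pi.smul_apply, Algebra.smul_def]))
    (fun x => (hmem _).2 fun v => by
      rw [Pi.smul_apply, Algebra.smul_def]
      exact J.mul_mem_right _ hwJ)
    (fun x hx hDx => by
      obtain ⟨y, hy, hxy⟩ := exists_sub_koszulD_mem_of_regular a b J (hpot ▸ hwJ) l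
        (fun i hi c hc => by
          have h1 := hregular.2 ⟨i, hi⟩ (Ideal.Quotient.mk J c)
          rw [← map_mul, mk_mem_span_image_iff J fun u => b (Fin.castAdd r u),
            mk_mem_span_image_iff J fun u => b (Fin.castAdd r u), image_castAdd_Iio] at h1
          exact h1 hc)
        (Nat.le_add_right l r) x
        (fun v hv => by
          rw [← range_castAdd, ← hI, eq_append_false hv]
          exact Ideal.mem_sup_right ((hG0 x).1 hx _))
        ((hmem _).1 hDx)
      refine ⟨y, (hG0 y).2 fun v => ?_, (hmem _).2 hxy⟩
      rw [hy _ fun i hi => ?_]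
      · exact zero_mem I
      · exact Fin.append_left (fun _ : Fin l => false) v ⟨i, hi⟩)
  have hG'mem (Q : AddSubgroup ((Fin (l + r) → Bool) → R)) (K : Set ((Fin (l + r) → Bool) → R))
      (hK : ∀ x ∈ K, ∀ γ, (DirectSum.decompose (piGrading ℛ (koszulDeg dega N) parityK) x γ :
        (Fin (l + r) → Bool) → R) ∈ K)
      (hQ : ∀ γ, ∀ x ∈ piGrading ℛ (koszulDeg dega N) parityK γ, x ∈ K → x ≠ 0 →
        G' (G x) ∈ Q) (x : (Fin (l + r) → Bool) → R) (hx : x ∈ K) : G' (G x) ∈ Q :=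
    mem_of_homogeneous_of_decompose_mem _ (G' ∘ₗ G).toAddMonoidHom Q K hK
      (fun γ x hx hxK => by
        by_cases h0 : x = 0
        · rw [h0, map_zero]
          exact zero_mem Q
        · exact hQ γ x hx hxK h0) hx
  refine ⟨G, G', fun x => funext fun v => mk_koszulD_append_false a b I hbI x v, hG'D,
    fun c x hx v hv => ?_, fun c y hy => ?_, fun g x hx v => ?_, fun g y hy => ?_, ⟨h, hh⟩,
    0, fun y => ?_⟩
  · change Ideal.Quotient.mk I _ = 0
    rw [hx _ (by rwa [parityK_append_false]), map_zero]
  · obtain ⟨x, hx, hx0⟩ := exists_extend_append_false (l := l)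
      fun v => if y v = 0 then 0 else (y v).out
    have hGx : G x = y := (hG _ x hx).trans (funext fun v => by
      split_ifs with h0
      · rw [h0, map_zero]
      · exact Ideal.Quotient.mk_out (y v))
    rw [← hGx]
    refine hG'mem
      { carrier := {x | ∀ v, parityK v ≠ c → x v = 0}
        add_mem' := fun hx hy v hv => by rw [Pi.add_apply, hx v hv, hy v hv, add_zero]
        zero_mem' := fun v _ => rfl
        neg_mem' := fun hx v hv => by rw [Pi.neg_apply, hx v hv, neg_zero] }
      {x | ∀ v, parityK v ≠ c → x v = 0} (fun x hx γ v hv => ?_) (fun γ x hxγ hx h0 => ?_) x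
      fun v hv => ?_
    · rw [decompose_piGrading_apply, hx v hv]
      simp
    · have hγ : γ.2 = c := by
        by_contra hγ
        refine h0 (funext fun v => ?_)
        by_cases hv : parityK v = γ.2
        · exact hx v (hv ▸ hγ)
        · exact (hxγ v).2 hv
      exact fun v hv => (hG'deg γ x hxγ v).2 (hγ ▸ hv)
    · rcases hx0 v with h0 | ⟨v, rfl⟩
      · exact h0
      · rw [parityK_append_false] at hv
        rw [hx, if_pos (hy v hv)]
  · rw [← koszulDeg_append_false]
    exact ⟨_, hx _, rfl⟩
  · choose z hz hzy using hy
    obtain ⟨x, hx, hx0⟩ := exists_extend_append_false (l := l) z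
    have hGx : G x = y := (hG _ x hx).trans (funext hzy)
    rw [← hGx]
    refine hG'mem
      { carrier := DegSet ℛ dega N g
        add_mem' := fun hx hy v => add_mem (hx v) (hy v)
        zero_mem' := fun v => zero_mem _
        neg_mem' := fun hx v => neg_mem (hx v) }
      (DegSet ℛ dega N g) (fun x hx γ v => ?_) (fun γ x hxγ hx h0 => ?_) x fun v => ?_
    · rw [decompose_piGrading_apply]
      split_ifs
      · by_cases hγ : γ.1 = g
        · rw [hγ]
          exact Subtype.prop _
        · rw [DirectSum.decompose_of_mem_ne ℛ (hx v) fun h' => hγ (sub_left_injective h').symm]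
          exact zero_mem _
      · exact zero_mem _
    · obtain ⟨v, hv⟩ := Function.ne_iff.1 h0
      have hγ : γ.1 = g := sub_left_injective
        (DirectSum.degree_eq_of_mem_mem ℛ (hxγ v).1 (hx v) hv)
      exact fun v => hγ ▸ (hG'deg γ x hxγ v).1
    · rcases hx0 v with h0 | ⟨v, rfl⟩
      · rw [h0]
        exact zero_mem _
      · rw [hx, koszulDeg_append_false]
        exact hz v
  · have h0 := map_zero (koszulLinearMap (MvPolynomial (Fin n) ℂ)
      (fun t : Fin r => Ideal.Quotient.mk I (a (Fin.natAdd l t)))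
      (fun t : Fin r => Ideal.Quotient.mk I (b (Fin.natAdd l t))))
    rw [hGG', sub_self, LinearMap.zero_apply, LinearMap.zero_apply, add_zero]
    exact h0.symm
end
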